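/- arXiv:1012.3727 — 5 statements merged into one kernel-verified Lean document; each statement's English description precedes it below -/
import Mathlib

section
/- Assume the presentation of the compact polytope Δ ⊆ ℝ^n is simple and exact. Suppose that for every subset I ⊆ {1,…,N} with F_I nonempty we are given a point x_I ∈ relint F_I and a real number α_I ≥ 0, such that α_I < α_J whenever I ⊊ J and F_J is nonempty. Then there exists a smooth function f : ℝ^n → ℝ such that for every I with F_I nonempty: (i) f(x_I) = α_I, f(x_I) ≤ f(y) for all y ∈ F_I, and f(y) = f(x_I) for y ∈ F_I implies y = x_I; and (ii) for every x ∈ relint F_I, the derivative Df_x vanishes identically on ⋂_{i ∈ I} ker φ_i if and only if x = x_I. -/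
noncomputable section

/-- The polytope `Δ = {x ∈ ℝⁿ : φ i x ≤ λ i for all i}` cut out by the linear
functionals `φ i` and bounds `lam i`. -/
def polyDelta {n N : ℕ} (φ : Fin N → ((Fin n → ℝ) →ₗ[ℝ] ℝ)) (lam : Fin N → ℝ) :
    Set (Fin n → ℝ) :=
  {x | ∀ i, φ i x ≤ lam i}

/-- The face `F_I = {x ∈ Δ : φ i x = λ i for all i ∈ I}`. -/
def polyFace {n N : ℕ} (φ : Fin N → ((Fin n → ℝ) →ₗ[ℝ] ℝ)) (lam : Fin N → ℝ)
    (I : Finset (Fin N)) : Set (Fin n → ℝ) :=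
  {x ∈ polyDelta φ lam | ∀ i ∈ I, φ i x = lam i}

/-- The relative interior of the face `F_I`:
`{x ∈ Δ : φ i x = λ i for i ∈ I and φ j x < λ j for j ∉ I}`. -/
def polyRelint {n N : ℕ} (φ : Fin N → ((Fin n → ℝ) →ₗ[ℝ] ℝ)) (lam : Fin N → ℝ)
    (I : Finset (Fin N)) : Set (Fin n → ℝ) :=
  {x ∈ polyDelta φ lam | (∀ i ∈ I, φ i x = lam i) ∧ ∀ j ∉ I, φ j x < lam j}

/-- The presentation is *simple* if at every point of `Δ` the active functionals are
linearly independent. -/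
def SimplePresentation {n N : ℕ} (φ : Fin N → ((Fin n → ℝ) →ₗ[ℝ] ℝ)) (lam : Fin N → ℝ) :
    Prop :=
  ∀ x ∈ polyDelta φ lam,
    LinearIndependent ℝ (fun i : {i : Fin N // φ i x = lam i} => φ i.1)

/-- The presentation is *exact* if `relint F_I` is nonempty whenever `F_I` is nonempty. -/
def ExactPresentation {n N : ℕ} (φ : Fin N → ((Fin n → ℝ) →ₗ[ℝ] ℝ)) (lam : Fin N → ℝ) :
    Prop :=
  ∀ I : Finset (Fin N), (polyFace φ lam I).Nonempty → (polyRelint φ lam I).Nonempty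

section SmoothConvexMax

variable {E : Type*} [NormedAddCommGroup E] [NormedSpace ℝ E] [FiniteDimensional ℝ E]

/-- Averaging an affine function against a symmetric bump of total mass one reproduces it. -/
lemma integral_normed_bump_mul_affine [MeasurableSpace E] [BorelSpace E]
    (μ : MeasureTheory.Measure E) [μ.IsAddHaarMeasure] (ρ : ContDiffBump (0 : E))
    (L : E →L[ℝ] ℝ) (b : ℝ) (x : E) :
    ∫ t, ρ.normed μ t * (L (x - t) + b) ∂μ = L x + b := by
  have hodd : ∫ t, ρ.normed μ t * L t ∂μ = 0 := by
    have h := MeasureTheory.integral_neg_eq_self (fun t => ρ.normed μ t * L t) μ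
    simp only [ρ.normed_neg, map_neg, mul_neg, MeasureTheory.integral_neg] at h
    linarith
  have hcont : Continuous (ρ.normed μ) := ρ.continuous_normed
  have hsupp : HasCompactSupport (ρ.normed μ) := ρ.hasCompactSupport_normed
  have hint₁ : MeasureTheory.Integrable (fun t => ρ.normed μ t * L t) μ :=
    (hcont.mul L.continuous).integrable_of_hasCompactSupport hsupp.mul_right
  have hint₂ : MeasureTheory.Integrable (fun t => ρ.normed μ t * (L x + b)) μ :=
    (hcont.integrable_of_hasCompactSupport hsupp).mul_const _
  calc ∫ t, ρ.normed μ t * (L (x - t) + b) ∂μ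
      = ∫ t, (ρ.normed μ t * (L x + b) - ρ.normed μ t * L t) ∂μ := by
        congr 1; ext t; rw [map_sub]; ring
    _ = L x + b := by
        rw [MeasureTheory.integral_sub hint₂ hint₁, hodd, MeasureTheory.integral_mul_const,
          ρ.integral_normed]
        ring

/-- A smooth convex majorant of finitely many affine functions that agrees with each of them
at a prescribed point where it strictly dominates all the others. -/
lemma exists_contDiff_convexOn_ge_affine {ι : Type*} (S : Finset ι) (hS : S.Nonempty)
    (L : ι → E →L[ℝ] ℝ) (b : ι → ℝ) (p : ι → E)
    (hp : ∀ i ∈ S, ∀ j ∈ S, j ≠ i → L j (p i) + b j < L i (p i) + b i) :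
    ∃ g : E → ℝ, ContDiff ℝ (⊤ : ℕ∞) g ∧ ConvexOn ℝ Set.univ g ∧
      (∀ i ∈ S, ∀ x, L i x + b i ≤ g x) ∧ ∀ i ∈ S, g (p i) = L i (p i) + b i := by
  borelize E
  let μ : MeasureTheory.Measure E := MeasureTheory.Measure.addHaar
  set M : E → ℝ := fun x => S.sup' hS fun i => L i x + b i with hM
  have hMcont : Continuous M :=
    Continuous.finset_sup'_apply hS fun i _ => by fun_prop
  have hle : ∀ i ∈ S, ∀ x, L i x + b i ≤ M x := fun i hi x =>
    Finset.le_sup' (fun i => L i x + b i) hi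
  have hMconv : ∀ (x y : E) (s t : ℝ), 0 ≤ s → 0 ≤ t → s + t = 1 →
      M (s • x + t • y) ≤ s * M x + t * M y := by
    intro x y s t hs ht hst
    refine Finset.sup'_le hS _ fun i hi => ?_
    have h₁ := mul_le_mul_of_nonneg_left (hle i hi x) hs
    have h₂ := mul_le_mul_of_nonneg_left (hle i hi y) ht
    have h₃ : L i (s • x + t • y) + b i = s * (L i x + b i) + t * (L i y + b i) := by
      simp only [map_add, map_smul, smul_eq_mul]
      linear_combination -b i * hst
    linarith
  -- near `p i` the maximum is attained by the `i`-th function alone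
  have hlocal : ∀ i ∈ S, ∀ᶠ t in nhds (0 : E), M (p i - t) = L i (p i - t) + b i := by
    intro i hi
    have h : ∀ᶠ t in nhds (0 : E), ∀ j ∈ S, L j (p i - t) + b j ≤ L i (p i - t) + b i := by
      rw [Filter.eventually_all_finset]
      intro j hj
      rcases eq_or_ne j i with rfl | hji
      · exact Filter.Eventually.of_forall fun _ => le_rfl
      · have hj' : ∀ᶠ t in nhds (0 : E), L j (p i - t) + b j < L i (p i - t) + b i :=
          ContinuousAt.eventually_lt (by fun_prop) (by fun_prop)
            (by simpa using hp i hi j hj hji)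
        exact hj'.mono fun _ => le_of_lt
    filter_upwards [h] with t ht
    exact le_antisymm (Finset.sup'_le hS _ ht) (hle i hi _)
  obtain ⟨r, hr, hball⟩ := Metric.eventually_nhds_iff_ball.1
    ((Filter.eventually_all_finset S).2 hlocal)
  let ρ : ContDiffBump (0 : E) := ⟨r / 2, r, half_pos hr, half_lt_self hr⟩
  have hcont : Continuous (ρ.normed μ) := ρ.continuous_normed
  have hsupp : HasCompactSupport (ρ.normed μ) := ρ.hasCompactSupport_normed
  have hintegrable : ∀ h : E → ℝ, Continuous h → ∀ x,
      MeasureTheory.Integrable (fun t => ρ.normed μ t * h (x - t)) μ := fun h hh x =>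
    (hcont.mul (by fun_prop : Continuous fun t => h (x - t))).integrable_of_hasCompactSupport
      hsupp.mul_right
  refine ⟨fun x => ∫ t, ρ.normed μ t * M (x - t) ∂μ, ?_, ⟨convex_univ, ?_⟩, ?_, ?_⟩
  · exact hsupp.contDiff_convolution_left (ContinuousLinearMap.lsmul ℝ ℝ) ρ.contDiff_normed
      (hMcont.locallyIntegrable (μ := μ))
  · intro x _ y _ s t hs ht hst
    simp only [smul_eq_mul]
    rw [← MeasureTheory.integral_const_mul, ← MeasureTheory.integral_const_mul,
      ← MeasureTheory.integral_add ((hintegrable M hMcont x).const_mul s)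
        ((hintegrable M hMcont y).const_mul t)]
    refine MeasureTheory.integral_mono (hintegrable M hMcont _)
      (((hintegrable M hMcont x).const_mul s).add ((hintegrable M hMcont y).const_mul t))
      fun w => ?_
    have hw : s • x + t • y - w = s • (x - w) + t • (y - w) := by
      rw [smul_sub, smul_sub, sub_add_sub_comm, ← add_smul, hst, one_smul]
    have h := mul_le_mul_of_nonneg_left (hMconv (x - w) (y - w) s t hs ht hst)
      (ρ.nonneg_normed w (μ := μ))
    simp only [hw]
    linarith
  · intro i hi x
    rw [← integral_normed_bump_mul_affine μ ρ (L i) (b i) x]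
    exact MeasureTheory.integral_mono (hintegrable (fun y => L i y + b i) (by fun_prop) x)
      (hintegrable M hMcont x)
      fun t => mul_le_mul_of_nonneg_left (hle i hi _) (ρ.nonneg_normed t)
  · intro i hi
    rw [← integral_normed_bump_mul_affine μ ρ (L i) (b i) (p i)]
    refine MeasureTheory.integral_congr_ae (Filter.Eventually.of_forall fun t => ?_)
    by_cases ht : t ∈ Metric.ball (0 : E) r
    · simp only [hball t ht i hi]
    · have h0 : ρ.normed μ t = 0 := by
        rw [← Function.notMem_support, ρ.support_normed_eq]
        exact ht
      simp only [h0, zero_mul]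

end SmoothConvexMax

/-- A convex function lies above its tangent hyperplanes. -/
lemma ConvexOn.add_fderiv_le {E : Type*} [NormedAddCommGroup E] [NormedSpace ℝ E] {f : E → ℝ}
    (hf : ConvexOn ℝ Set.univ f) {x : E} (hd : DifferentiableAt ℝ f x) (y : E) :
    f x + fderiv ℝ f x (y - x) ≤ f y := by
  have hconv : ConvexOn ℝ Set.univ (f ∘ AffineMap.lineMap (k := ℝ) x y) :=
    hf.comp_affineMap (AffineMap.lineMap x y)
  have hderiv : HasDerivAt (f ∘ AffineMap.lineMap (k := ℝ) x y) (fderiv ℝ f x (y - x)) 0 := by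
    refine HasFDerivAt.comp_hasDerivAt (0 : ℝ) ?_ AffineMap.hasDerivAt_lineMap
    simpa using hd.hasFDerivAt
  have h := hconv.le_slope_of_hasDerivAt (Set.mem_univ 0) (Set.mem_univ 1) one_pos hderiv
  simp only [slope_def_field, Function.comp_apply, AffineMap.lineMap_apply_one,
    AffineMap.lineMap_apply_zero, sub_zero, div_one] at h
  linarith

/-- If `f ≥ f p` along the line through `p` in direction `u`, then the
derivative of `f` at `p` vanishes on `u`. -/
lemma fderiv_apply_eq_zero_of_forall_le {E : Type*} [NormedAddCommGroup E] [NormedSpace ℝ E]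
    {f : E → ℝ} {p u : E} (hd : DifferentiableAt ℝ f p) (h : ∀ t : ℝ, f p ≤ f (p + t • u)) :
    fderiv ℝ f p u = 0 := by
  have hmin : IsLocalMin (fun t : ℝ => f (p + t • u)) 0 :=
    Filter.Eventually.of_forall fun t => by simpa using h t
  exact hmin.hasDerivAt_eq_zero (hd.hasFDerivAt.hasLineDerivAt u)

lemma real_dotProduct_self_nonneg {n : ℕ} (x : Fin n → ℝ) : 0 ≤ x ⬝ᵥ x :=
  Finset.sum_nonneg fun i _ => mul_self_nonneg (x i)

/-- Constants making each of the quadratic functions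
`x ↦ α I + c * ∑ i ∈ I, (φ i x - lam i) + ε * |x - xpt I|²` the strict maximum at `xpt I`. -/
lemma exists_separating_constants {n N : ℕ} (φ : Fin N → ((Fin n → ℝ) →ₗ[ℝ] ℝ))
    (lam : Fin N → ℝ) (xpt : Finset (Fin N) → (Fin n → ℝ)) (α : Finset (Fin N) → ℝ)
    (hxpt : ∀ I, (polyFace φ lam I).Nonempty → xpt I ∈ polyRelint φ lam I)
    (hαlt : ∀ I J : Finset (Fin N), I ⊂ J → (polyFace φ lam J).Nonempty → α I < α J) :
    ∃ ε c : ℝ, 0 < ε ∧ ∀ I J : Finset (Fin N), (polyFace φ lam I).Nonempty →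
      J ≠ I → α J + c * ∑ j ∈ J, (φ j (xpt I) - lam j) +
        ε * ((xpt I - xpt J) ⬝ᵥ (xpt I - xpt J)) < α I := by
  obtain ⟨ε, hε, hsub⟩ : ∃ ε : ℝ, 0 < ε ∧ ∀ I J : Finset (Fin N),
      (polyFace φ lam I).Nonempty → J ⊂ I →
        α J + ε * ((xpt I - xpt J) ⬝ᵥ (xpt I - xpt J)) < α I := by
    have h : ∀ᶠ ε in nhdsWithin (0 : ℝ) (Set.Ioi 0), ∀ I J : Finset (Fin N),
        (polyFace φ lam I).Nonempty → J ⊂ I →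
          α J + ε * ((xpt I - xpt J) ⬝ᵥ (xpt I - xpt J)) < α I := by
      simp only [Filter.eventually_all]
      intro I J hI hJI
      apply nhdsWithin_le_nhds
      exact ContinuousAt.eventually_lt (by fun_prop) (by fun_prop)
        (by simpa using hαlt J I hJI hI)
    exact ((eventually_mem_nhdsWithin.and h).exists)
  have h : ∀ᶠ c in Filter.atTop, ∀ I J : Finset (Fin N), (polyFace φ lam I).Nonempty →
      J ≠ I → α J + c * ∑ j ∈ J, (φ j (xpt I) - lam j) +
        ε * ((xpt I - xpt J) ⬝ᵥ (xpt I - xpt J)) < α I := by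
    simp only [Filter.eventually_all]
    intro I J hI hJI
    obtain ⟨hΔ, heq, hlt⟩ := hxpt I hI
    by_cases hsubset : J ⊆ I
    · have h0 : ∑ j ∈ J, (φ j (xpt I) - lam j) = 0 :=
        Finset.sum_eq_zero fun j hj => sub_eq_zero.2 (heq j (hsubset hj))
      refine Filter.Eventually.of_forall fun c => ?_
      rw [h0, mul_zero, add_zero]
      exact hsub I J hI (hsubset.ssubset_of_ne hJI)
    · obtain ⟨k, hkJ, hkI⟩ := Finset.not_subset.1 hsubset
      have hneg : ∑ j ∈ J, (φ j (xpt I) - lam j) < 0 :=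
        Finset.sum_neg' (fun j _ => sub_nonpos.2 (hΔ j)) ⟨k, hkJ, sub_neg.2 (hlt k hkI)⟩
      have htend := (Filter.tendsto_id (α := ℝ) (x := Filter.atTop)).atTop_mul_const_of_neg hneg
      filter_upwards [htend.eventually_lt_atBot
        (α I - α J - ε * ((xpt I - xpt J) ⬝ᵥ (xpt I - xpt J)))] with c hc
      simp only [id] at hc
      linarith
  obtain ⟨c, hc⟩ := h.exists
  exact ⟨ε, c, hε, hc⟩

/-- A smooth convex function with value `α I` at `xpt I` that dominates a quadratic function
restricting on the affine span of the face `F_I` to `α I + ε * |x - xpt I|²`. -/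
lemma exists_contDiff_convexOn_ge_quadratic {n N : ℕ} (φ : Fin N → ((Fin n → ℝ) →ₗ[ℝ] ℝ))
    (lam : Fin N → ℝ) (hne : (polyDelta φ lam).Nonempty)
    (xpt : Finset (Fin N) → (Fin n → ℝ)) (α : Finset (Fin N) → ℝ)
    (hxpt : ∀ I, (polyFace φ lam I).Nonempty → xpt I ∈ polyRelint φ lam I)
    (hαlt : ∀ I J : Finset (Fin N), I ⊂ J → (polyFace φ lam J).Nonempty → α I < α J) :
    ∃ (f : (Fin n → ℝ) → ℝ) (ε : ℝ), 0 < ε ∧ ContDiff ℝ (⊤ : ℕ∞) f ∧ ConvexOn ℝ Set.univ f ∧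
      ∀ I, (polyFace φ lam I).Nonempty → f (xpt I) = α I ∧
        ∀ x, (∀ i ∈ I, φ i x = lam i) →
          α I + ε * ((x - xpt I) ⬝ᵥ (x - xpt I)) ≤ f x := by
  classical
  obtain ⟨ε, c, hε, hsep⟩ := exists_separating_constants φ lam xpt α hxpt hαlt
  let S : Finset (Finset (Fin N)) := {I | (polyFace φ lam I).Nonempty}
  have hmem : ∀ I, I ∈ S ↔ (polyFace φ lam I).Nonempty := fun I => by simp [S]
  have hS : S.Nonempty :=
    ⟨∅, (hmem ∅).2 (hne.mono fun x hx => ⟨hx, fun i hi => absurd hi (Finset.notMem_empty i)⟩)⟩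
  let L : Finset (Fin N) → (Fin n → ℝ) →L[ℝ] ℝ := fun I =>
    LinearMap.toContinuousLinearMap
      (c • ∑ i ∈ I, φ i - (2 * ε) • dotProductBilin ℝ ℝ (xpt I))
  let b : Finset (Fin N) → ℝ := fun I =>
    α I - c * ∑ i ∈ I, lam i + ε * (xpt I ⬝ᵥ xpt I)
  have hform : ∀ I x, L I x + b I + ε * (x ⬝ᵥ x) =
      α I + c * ∑ i ∈ I, (φ i x - lam i) + ε * ((x - xpt I) ⬝ᵥ (x - xpt I)) := by
    intro I x
    simp only [L, b, LinearMap.coe_toContinuousLinearMap', LinearMap.sub_apply,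
      LinearMap.smul_apply, LinearMap.sum_apply, smul_eq_mul, dotProductBilin_apply_apply,
      Finset.sum_sub_distrib, sub_dotProduct, dotProduct_sub, dotProduct_comm x (xpt I)]
    ring
  have hself : ∀ I ∈ S, L I (xpt I) + b I + ε * (xpt I ⬝ᵥ xpt I) = α I := by
    intro I hI
    have h0 : ∑ i ∈ I, (φ i (xpt I) - lam i) = 0 :=
      Finset.sum_eq_zero fun i hi => sub_eq_zero.2 ((hxpt I ((hmem I).1 hI)).2.1 i hi)
    simp [hform, h0]
  obtain ⟨g, hgsmooth, hgconv, hgle, hgeq⟩ := exists_contDiff_convexOn_ge_affine S hS L b xpt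
    (fun I hI J hJ hJI => by
      have h := hsep I J ((hmem I).1 hI) hJI
      rw [← hform, ← hself I hI] at h
      linarith)
  refine ⟨fun x => g x + ε * (x ⬝ᵥ x), ε, hε, ?_, ?_, fun I hI => ⟨?_, fun x hx => ?_⟩⟩
  · refine hgsmooth.add (contDiff_const.mul ?_)
    unfold dotProduct
    fun_prop
  · refine hgconv.add ⟨convex_univ, fun x _ y _ s t hs ht hst => ?_⟩
    have hsq : 0 ≤ s * t * (ε * ((x - y) ⬝ᵥ (x - y))) :=
      mul_nonneg (mul_nonneg hs ht) (mul_nonneg hε.le (real_dotProduct_self_nonneg _))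
    obtain rfl : t = 1 - s := by linarith
    simp only [sub_dotProduct, dotProduct_sub, add_dotProduct, dotProduct_add, smul_dotProduct,
      dotProduct_smul, smul_eq_mul, dotProduct_comm y x] at hsq ⊢
    linarith
  · simp only [hgeq I ((hmem I).2 hI), hself I ((hmem I).2 hI)]
  · have h0 : ∑ i ∈ I, (φ i x - lam i) = 0 :=
      Finset.sum_eq_zero fun i hi => sub_eq_zero.2 (hx i hi)
    have h := hform I x
    rw [h0, mul_zero, add_zero] at h
    linarith [hgle I ((hmem I).2 hI) x]

/-- **Proposition A.1(A)+(B).** Let `Δ ⊆ ℝⁿ` be a compact polytope with nonempty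
interior whose presentation is simple and exact.  Given, for each `I` with `F_I`
nonempty, a point `x_I ∈ relint F_I` and a value `α_I ≥ 0` such that `α_I < α_J`
whenever `I ⊊ J` and `F_J ≠ ∅`, there exists a smooth function `f : ℝⁿ → ℝ` whose
minimum over each face `F_I` is attained exactly at `x_I` with value `α_I`, and whose
restriction to `relint F_I` has no critical point other than `x_I`. -/
theorem exists_smooth_function_prescribed_critical_points_on_faces
    {n N : ℕ} (hn : 0 < n) (hN : 0 < N)
    (φ : Fin N → ((Fin n → ℝ) →ₗ[ℝ] ℝ)) (lam : Fin N → ℝ)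
    (hcpt : IsCompact (polyDelta φ lam))
    (hint : (interior (polyDelta φ lam)).Nonempty)
    (hsimple : SimplePresentation φ lam)
    (hexact : ExactPresentation φ lam)
    (xpt : Finset (Fin N) → (Fin n → ℝ)) (α : Finset (Fin N) → ℝ)
    (hxpt : ∀ I, (polyFace φ lam I).Nonempty → xpt I ∈ polyRelint φ lam I)
    (hα0 : ∀ I, (polyFace φ lam I).Nonempty → 0 ≤ α I)
    (hαlt : ∀ I J : Finset (Fin N), I ⊂ J → (polyFace φ lam J).Nonempty → α I < α J) :
    ∃ f : (Fin n → ℝ) → ℝ, ContDiff ℝ (⊤ : ℕ∞) f ∧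
      ∀ I : Finset (Fin N), (polyFace φ lam I).Nonempty →
        f (xpt I) = α I ∧
        (∀ y ∈ polyFace φ lam I, f (xpt I) ≤ f y) ∧
        (∀ y ∈ polyFace φ lam I, f y = f (xpt I) → y = xpt I) ∧
        ∀ x ∈ polyRelint φ lam I,
          ((∀ u : Fin n → ℝ, (∀ i ∈ I, φ i u = 0) → fderiv ℝ f x u = 0) ↔ x = xpt I) := by
  obtain ⟨f, ε, hε, hsmooth, hconv, hf⟩ := exists_contDiff_convexOn_ge_quadratic φ lam
    (hint.mono interior_subset) xpt α hxpt hαlt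
  have hdiff : Differentiable ℝ f := hsmooth.differentiable (by simp)
  refine ⟨f, hsmooth, fun I hI => ?_⟩
  obtain ⟨hval, hge⟩ := hf I hI
  have hmin : ∀ x, (∀ i ∈ I, φ i x = lam i) → f (xpt I) ≤ f x := fun x hx => by
    have := mul_nonneg hε.le (real_dotProduct_self_nonneg (x - xpt I))
    linarith [hge x hx]
  have huniq : ∀ x, (∀ i ∈ I, φ i x = lam i) → f x ≤ f (xpt I) → x = xpt I := by
    intro x hx hle
    have hnonneg := real_dotProduct_self_nonneg (x - xpt I)
    have hzero : (x - xpt I) ⬝ᵥ (x - xpt I) = 0 := by nlinarith [hge x hx]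
    exact sub_eq_zero.1 (dotProduct_self_eq_zero.1 hzero)
  have hxI : ∀ i ∈ I, φ i (xpt I) = lam i := (hxpt I hI).2.1
  refine ⟨hval, fun y hy => hmin y hy.2, fun y hy h => huniq y hy.2 h.le, fun x hx => ⟨?_, ?_⟩⟩
  · intro hcrit
    have htangent := hconv.add_fderiv_le (hdiff x) (xpt I)
    rw [hcrit _ fun i hi => by rw [map_sub, hxI i hi, hx.2.1 i hi, sub_self], add_zero]
      at htangent
    exact huniq x hx.2.1 htangent
  · rintro rfl u hu
    exact fderiv_apply_eq_zero_of_forall_le (hdiff _) fun t => hmin _ fun i hi => by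
      rw [map_add, map_smul, hu i hi, smul_zero, add_zero, hxI i hi]
end
end

section
/- Assume the presentation of the compact polytope Δ ⊆ ℝ^n is simple and exact, and suppose given data (x_I, α_I) as follows: for every I ⊆ {1,…,N} with F_I nonempty, a point x_I ∈ relint F_I and a real α_I ≥ 0, with α_I < α_J whenever I ⊊ J and F_J ≠ ∅. Then there exists a smooth function f : ℝ^n → ℝ such that: (i) for every such I, f(x_I) = α_I, the minimum of f over F_I is attained at x_I and only at x_I, and for x ∈ relint F_I the derivative Df_x vanishes on ⋂_{i∈I} ker φ_i if and only if x = x_I; and (ii) for every such I, writing ℓ = n − |I|, there exist ε > 0, b > 0, and an affine automorphism A of ℝ^n with A(x_I) = 0 such that A maps Δ ∩ A⁻¹((−ε,ε)^n) bijectively onto (−ε,ε)^ℓ × [0,ε)^{n−ℓ}, and for every z = (z_1,…,z_n) ∈ (−ε,ε)^ℓ × [0,ε)^{n−ℓ} one has f(A⁻¹(z)) = α_I + b·(Σ_{j=1}^{ℓ} z_j² − Σ_{j=ℓ+1}^{n} z_j). -/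
noncomputable section

section AuxiliaryLemmas

open Set Filter Topology
open scoped ContDiff

/-- For every `η > 0` there is a smooth convex approximation `χ` of `t ↦ max t 0` which agrees
with it outside `(-η, η)` and for which both `χ` and `t - χ t` are monotone. -/
theorem exists_smooth_convex_posPart {η : ℝ} (hη : 0 < η) :
    ∃ χ : ℝ → ℝ, ContDiff ℝ ∞ χ ∧ ConvexOn ℝ univ χ ∧ Monotone χ ∧
      Monotone (fun t => t - χ t) ∧ (∀ t ≤ -η, χ t = 0) ∧ ∀ t, η ≤ t → χ t = t := by
  let s : ℝ → ℝ := fun u => Real.smoothTransition (u / η)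
  have hs : ContDiff ℝ ∞ s := by
    have : ContDiff ℝ ∞ Real.smoothTransition := Real.smoothTransition.contDiff (n := ⊤)
    exact this.comp (by fun_prop)
  have hs0 : ∀ u, 0 ≤ s u := fun u => Real.smoothTransition.nonneg _
  have hs1 : ∀ u, s u ≤ 1 := fun u => Real.smoothTransition.le_one _
  have hsm : Monotone s := fun a b hab =>
    Real.smoothTransition.monotone (by gcongr)
  let S : ℝ → ℝ := fun t => ∫ u in (0 : ℝ)..t, s u
  have hS : ∀ t, HasDerivAt S (s t) t := fun t =>
    (hs.continuous.integral_hasStrictDerivAt 0 t).hasDerivAt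
  have hSd : Differentiable ℝ S := fun t => (hS t).differentiableAt
  have hSderiv : deriv S = s := funext fun t => (hS t).deriv
  have hSsmooth : ContDiff ℝ ∞ S :=
    contDiff_infty_iff_deriv.2 ⟨hSd, hSderiv ▸ hs⟩
  have hSmono : Monotone S := monotone_of_deriv_nonneg hSd fun t => by
    rw [hSderiv]; exact hs0 t
  have hSmono' : Monotone (fun t => t - S t) := by
    refine monotone_of_deriv_nonneg (by fun_prop) fun t => ?_
    rw [((hasDerivAt_id' t).fun_sub (hS t)).deriv]
    linarith [hs1 t]
  have hSconv : ConvexOn ℝ univ S :=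
    Monotone.convexOn_univ_of_deriv hSd (hSderiv ▸ hsm)
  have hSneg : ∀ t ≤ 0, S t = 0 := fun t ht => by
    have : ∫ u in (0 : ℝ)..t, s u = ∫ u in (0 : ℝ)..t, (0 : ℝ) := by
      refine intervalIntegral.integral_congr fun u hu => ?_
      rw [uIcc_of_ge ht] at hu
      exact Real.smoothTransition.zero_of_nonpos (div_nonpos_of_nonpos_of_nonneg hu.2 hη.le)
    simpa [S] using this
  have hSpos : ∀ t, η ≤ t → S t = S η + (t - η) := fun t ht => by
    have h1 : S η + ∫ u in η..t, s u = S t :=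
      intervalIntegral.integral_add_adjacent_intervals
        (hs.continuous.intervalIntegrable _ _) (hs.continuous.intervalIntegrable _ _)
    have h2 : ∫ u in η..t, s u = ∫ u in η..t, (1 : ℝ) := by
      refine intervalIntegral.integral_congr fun u hu => ?_
      rw [uIcc_of_le ht] at hu
      exact Real.smoothTransition.one_of_one_le ((one_le_div hη).2 hu.1)
    rw [← h1, h2]
    simp
  have hκ0 : 0 ≤ η - S η := by
    have := hSmono' hη.le
    simp only [hSneg 0 le_rfl] at this
    linarith
  have hκ1 : η - S η ≤ η := by
    have := hSmono hη.le
    rw [hSneg 0 le_rfl] at this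
    linarith
  set κ := η - S η with hκ
  refine ⟨fun t => S (t + κ), hSsmooth.comp (by fun_prop), ?_, fun a b hab => hSmono (by gcongr),
    fun a b hab => ?_, fun t ht => hSneg _ (by linarith), fun t ht => ?_⟩
  · have := hSconv.translate_left κ
    rw [preimage_univ] at this
    exact this
  · have := hSmono' (add_le_add_left hab κ)
    dsimp only at this ⊢
    linarith
  · dsimp only
    rw [hSpos _ (by linarith)]
    linarith

/-- Convex functions are closed under the regularized maximum `g + χ (f - g)`. -/
theorem ConvexOn.add_comp_sub {E : Type*} [AddCommGroup E] [Module ℝ E] {s : Set E}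
    {f g : E → ℝ} {χ : ℝ → ℝ} (hf : ConvexOn ℝ s f) (hg : ConvexOn ℝ s g)
    (hχ : ConvexOn ℝ univ χ) (hmono : Monotone χ) (hmono' : Monotone (fun t => t - χ t)) :
    ConvexOn ℝ s (fun x => g x + χ (f x - g x)) := by
  refine ⟨hf.1, fun x hx y hy p q hp hq hpq => ?_⟩
  have h1 := hf.2 hx hy hp hq hpq
  have h2 := hg.2 hx hy hp hq hpq
  have h3 := hχ.2 (mem_univ (f x - g x)) (mem_univ (f y - g y)) hp hq hpq
  simp only [smul_eq_mul] at h1 h2 h3 ⊢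
  set F := f (p • x + q • y)
  set G := g (p • x + q • y)
  have h4 := hmono (sub_le_sub_right h1 G)
  have h5 := hmono' (sub_le_sub_left h2 (p * f x + q * f y))
  have h6 : p * f x + q * f y - (p * g x + q * g y) = p * (f x - g x) + q * (f y - g y) := by ring
  dsimp only at h5
  rw [h6] at h5
  linarith

/-- Smooth convex functions `g i` can be glued into one smooth convex function that agrees with
`g i` near `p i`, provided `g i` strictly dominates all the other functions at `p i`. -/
theorem exists_smooth_convex_eventuallyEq {E ι : Type*} [NormedAddCommGroup E] [NormedSpace ℝ E]
    [Finite ι] (p : ι → E) (g : ι → E → ℝ) (hg : ∀ i, ContDiff ℝ ∞ (g i))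
    (hconv : ∀ i, ConvexOn ℝ univ (g i)) (hlt : ∀ i k, i ≠ k → g i (p k) < g k (p k)) :
    ∃ f : E → ℝ, ContDiff ℝ ∞ f ∧ ConvexOn ℝ univ f ∧ ∀ i, f =ᶠ[𝓝 (p i)] g i := by
  classical
  have := Fintype.ofFinite ι
  suffices H : ∀ S : Finset ι, ∃ f : E → ℝ, ContDiff ℝ ∞ f ∧ ConvexOn ℝ univ f ∧
      (∀ i ∈ S, f =ᶠ[𝓝 (p i)] g i) ∧ ∀ i ∉ S, f (p i) < g i (p i) by
    obtain ⟨f, h1, h2, h3, -⟩ := H Finset.univ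
    exact ⟨f, h1, h2, fun i => h3 i (Finset.mem_univ i)⟩
  intro S
  induction S using Finset.induction_on with
  | empty =>
    obtain ⟨m, hm⟩ := (Set.finite_range fun i => g i (p i)).bddBelow
    refine ⟨fun _ => m - 1, contDiff_const, convexOn_const _ convex_univ, by simp, fun i _ => ?_⟩
    have : m ≤ g i (p i) := hm (mem_range_self i)
    linarith
  | insert j S hj ih =>
    obtain ⟨f, hf, hfc, hfS, hfN⟩ := ih
    have hfj : f (p j) < g j (p j) := hfN j hj
    obtain ⟨η, hη, hη1, hη2⟩ : ∃ η > 0, f (p j) - g j (p j) < -η ∧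
        ∀ i, i ≠ j → g j (p i) + η < g i (p i) ∧ (i ∉ S → f (p i) + η < g i (p i)) := by
      have ev : ∀ a b : ℝ, a < b → ∀ᶠ η in 𝓝[>] (0 : ℝ), a + η < b := fun a b hab => by
        have : Tendsto (fun η : ℝ => a + η) (𝓝[>] 0) (𝓝 (a + 0)) :=
          (tendsto_const_nhds.add tendsto_id).mono_left nhdsWithin_le_nhds
        exact this.eventually_lt_const (by simpa using hab)
      have h1 := ev _ _ hfj
      have h2 : ∀ᶠ η in 𝓝[>] (0 : ℝ), ∀ i, i ≠ j →
          g j (p i) + η < g i (p i) ∧ (i ∉ S → f (p i) + η < g i (p i)) := by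
        refine eventually_all.2 fun i => ?_
        by_cases hij : i = j
        · simp [hij]
        by_cases hiS : i ∈ S
        · filter_upwards [ev _ _ (hlt j i (Ne.symm hij))] with η h _
          exact ⟨h, fun h => absurd hiS h⟩
        · filter_upwards [ev _ _ (hlt j i (Ne.symm hij)), ev _ _ (hfN i hiS)] with η h h' _
          exact ⟨h, fun _ => h'⟩
      obtain ⟨η, ⟨h1, h2⟩, h0⟩ := ((h1.and h2).and self_mem_nhdsWithin).exists
      exact ⟨η, h0, by linarith, h2⟩
    obtain ⟨χ, hχ, hχc, hχm, hχm', hχ0, hχ1⟩ := exists_smooth_convex_posPart hη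
    refine ⟨fun x => g j x + χ (f x - g j x), (hg j).add (hχ.comp (hf.sub (hg j))),
      hfc.add_comp_sub (hconv j) hχc hχm hχm', fun i hi => ?_, fun i hi => ?_⟩
    · have hcont : Continuous (fun x => f x - g j x) := hf.continuous.sub (hg j).continuous
      by_cases hij : i = j
      · subst hij
        filter_upwards [hcont.continuousAt.eventually_lt_const hη1] with x hx
        rw [hχ0 _ hx.le, add_zero]
      · have hiS : i ∈ S := (Finset.mem_insert.1 hi).resolve_left hij
        have hlt' : η < f (p i) - g j (p i) := by
          rw [(hfS i hiS).eq_of_nhds]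
          linarith [(hη2 i hij).1]
        filter_upwards [hcont.continuousAt.eventually_const_lt hlt', hfS i hiS] with x hx hx'
        rw [hχ1 _ hx.le, ← hx']
        ring
    · rw [Finset.mem_insert, not_or] at hi
      obtain ⟨h1, h2⟩ := hη2 i hi.1
      have h2 := h2 hi.2
      rcases le_total (f (p i) - g j (p i)) η with h | h
      · have := hχm h
        rw [hχ1 η le_rfl] at this
        linarith
      · dsimp only
        rw [hχ1 _ h]
        linarith

/-- A linear automorphism `L` of `ℝⁿ` is adapted to the functionals `φ i`, `i ∈ I`, with factor `c`
if its last `|I|` coordinates are the functionals `-c • φ i`, `i ∈ I`. -/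
def IsFaceCoord {n N : ℕ} (φ : Fin N → ((Fin n → ℝ) →ₗ[ℝ] ℝ)) (I : Finset (Fin N)) (c : ℝ)
    (L : (Fin n → ℝ) ≃ₗ[ℝ] (Fin n → ℝ)) : Prop :=
  (∀ j : Fin n, ¬ (j : ℕ) < n - I.card → ∃ i ∈ I, ∀ v, L v j = -(c * φ i v)) ∧
    ∀ i ∈ I, ∃ j : Fin n, ¬ (j : ℕ) < n - I.card ∧ ∀ v, L v j = -(c * φ i v)

theorem exists_isFaceCoord_one {n N : ℕ} (φ : Fin N → ((Fin n → ℝ) →ₗ[ℝ] ℝ))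
    (I : Finset (Fin N)) (h : LinearIndependent ℝ (fun i : I => φ i.1)) :
    ∃ L, IsFaceCoord φ I 1 L := by
  have h' : LinearIndependent ℝ (fun i : I => (-φ i.1 : Module.Dual ℝ (Fin n → ℝ))) := h.neg
  let B := Module.Basis.sumExtend h'
  have hB : ∀ i : I, B (Sum.inl i) = -φ i.1 := fun i => by
    simp only [B, Module.Basis.sumExtend, Module.Basis.reindex_apply, Module.Basis.coe_extend]
    rfl
  have : Finite (I ⊕ Module.Basis.sumExtendIndex h') := Module.Finite.finite_basis B
  have : Finite (Module.Basis.sumExtendIndex h') :=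
    Finite.of_injective (Sum.inr : _ → I ⊕ Module.Basis.sumExtendIndex h') Sum.inr_injective
  have hcard : I.card + Nat.card (Module.Basis.sumExtendIndex h') = n := by
    have h1 := Module.finrank_eq_nat_card_basis B
    rw [Subspace.dual_finrank_eq, Module.finrank_fin_fun, Nat.card_sum,
      Nat.card_eq_fintype_card, Fintype.card_coe] at h1
    exact h1.symm
  let eκ : Fin (n - I.card) ≃ Module.Basis.sumExtendIndex h' :=
    (Finite.equivFinOfCardEq (by omega)).symm
  let e : Fin (n - I.card) ⊕ Fin I.card ≃ Fin n :=
    finSumFinEquiv.trans (finCongr (by omega))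
  have hel : ∀ a, ((e (Sum.inl a) : Fin n) : ℕ) < n - I.card := fun a => by simp [e]
  have her : ∀ a, ¬ ((e (Sum.inr a) : Fin n) : ℕ) < n - I.card := fun a => by simp [e]
  let B' : Module.Basis (Fin n) ℝ (Module.Dual ℝ (Fin n → ℝ)) :=
    B.reindex ((((Equiv.sumComm _ _).trans (Equiv.sumCongr eκ.symm I.equivFin))).trans e)
  have hB' : ∀ a : Fin I.card, B' (e (Sum.inr a)) = -φ (I.equivFin.symm a).1 := fun a => by
    simp [B', hB]
  let M : (Fin n → ℝ) →ₗ[ℝ] (Fin n → ℝ) := LinearMap.pi fun j => B' j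
  have hM : Function.Injective M := by
    rw [injective_iff_map_eq_zero]
    intro v hv
    rw [← Module.forall_dual_apply_eq_zero_iff ℝ]
    intro ψ
    have : Module.Dual.eval ℝ (Fin n → ℝ) v = 0 :=
      B'.ext fun j => congrFun hv j
    exact LinearMap.congr_fun this ψ
  refine ⟨LinearEquiv.ofInjectiveEndo M hM, fun j hj => ?_, fun i hi => ?_⟩
  · obtain ⟨a, rfl⟩ := e.surjective j
    rcases a with a | a
    · exact absurd (hel a) hj
    · exact ⟨_, (I.equivFin.symm a).2, fun v => by simp [M, hB']⟩
  · refine ⟨e (Sum.inr (I.equivFin ⟨i, hi⟩)), her _, fun v => by simp [M, hB']⟩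

/-- Adapted coordinates can be rescaled in the last `|I|` directions. -/
theorem IsFaceCoord.exists_scale {n N : ℕ} {φ : Fin N → ((Fin n → ℝ) →ₗ[ℝ] ℝ)}
    {I : Finset (Fin N)} {L : (Fin n → ℝ) ≃ₗ[ℝ] (Fin n → ℝ)} (hL : IsFaceCoord φ I 1 L)
    {c : ℝ} (hc : 0 < c) :
    ∃ L' : (Fin n → ℝ) ≃ₗ[ℝ] (Fin n → ℝ), IsFaceCoord φ I c L' ∧
      ∀ v j, L' v j = if (j : ℕ) < n - I.card then L v j else c * L v j := by
  let L' := L.trans (LinearEquiv.piCongrRight fun j : Fin n =>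
    LinearEquiv.smulOfNeZero ℝ ℝ (if (j : ℕ) < n - I.card then 1 else c)
      (by split_ifs <;> simp [hc.ne']))
  have hL' : ∀ v j, L' v j = if (j : ℕ) < n - I.card then L v j else c * L v j := by
    intro v j
    simp only [L', LinearEquiv.trans_apply, LinearEquiv.piCongrRight_apply,
      LinearEquiv.smulOfNeZero_apply, smul_eq_mul]
    split_ifs <;> simp
  refine ⟨L', ⟨fun j hj => ?_, fun i hi => ?_⟩, hL'⟩
  · obtain ⟨i, hi, h⟩ := hL.1 j hj
    exact ⟨i, hi, fun v => by rw [hL', if_neg hj, h]; ring⟩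
  · obtain ⟨j, hj, h⟩ := hL.2 i hi
    exact ⟨j, hj, fun v => by rw [hL', if_neg hj, h]; ring⟩

/-- The model function `a + b * (∑_{j < ℓ} z_j² - ∑_{j ≥ ℓ} z_j)` in the coordinates
`z = L (x - p)`. -/
def modelFn {n : ℕ} (ℓ : ℕ) (L : (Fin n → ℝ) ≃ₗ[ℝ] (Fin n → ℝ)) (p : Fin n → ℝ) (a b : ℝ)
    (x : Fin n → ℝ) : ℝ :=
  a + b * ∑ j : Fin n, (if (j : ℕ) < ℓ then (L (x - p) j) ^ 2 else -(L (x - p) j))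

theorem modelFn_self {n : ℕ} (ℓ : ℕ) (L : (Fin n → ℝ) ≃ₗ[ℝ] (Fin n → ℝ)) (p : Fin n → ℝ)
    (a b : ℝ) : modelFn ℓ L p a b p = a := by
  simp [modelFn]

theorem contDiff_modelFn {n : ℕ} (ℓ : ℕ) (L : (Fin n → ℝ) ≃ₗ[ℝ] (Fin n → ℝ)) (p : Fin n → ℝ)
    (a b : ℝ) : ContDiff ℝ ∞ (modelFn ℓ L p a b) := by
  have hL : ∀ j, ContDiff ℝ ∞ (fun x => L (x - p) j) := fun j => by
    have h : ContDiff ℝ ∞ L := L.toContinuousLinearEquiv.contDiff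
    exact (contDiff_apply ℝ ℝ j).comp (h.comp (by fun_prop))
  refine contDiff_const.add (contDiff_const.mul (ContDiff.sum fun j _ => ?_))
  split_ifs
  · exact (hL j).pow 2
  · exact (hL j).neg

theorem convexOn_modelFn {n : ℕ} (ℓ : ℕ) (L : (Fin n → ℝ) ≃ₗ[ℝ] (Fin n → ℝ)) (p : Fin n → ℝ)
    (a : ℝ) {b : ℝ} (hb : 0 < b) : ConvexOn ℝ univ (modelFn ℓ L p a b) := by
  refine ⟨convex_univ, fun x _ y _ s t hs ht hst => ?_⟩
  have hz : L (s • x + t • y - p) = s • L (x - p) + t • L (y - p) := by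
    rw [← map_smul, ← map_smul, ← map_add]
    congr 1
    have : p = s • p + t • p := by rw [← add_smul, hst, one_smul]
    nth_rewrite 1 [this]
    module
  have hsum : ∑ j : Fin n, (if (j : ℕ) < ℓ then (L (s • x + t • y - p) j) ^ 2
        else -(L (s • x + t • y - p) j)) ≤
      s * ∑ j : Fin n, (if (j : ℕ) < ℓ then (L (x - p) j) ^ 2 else -(L (x - p) j)) +
      t * ∑ j : Fin n, (if (j : ℕ) < ℓ then (L (y - p) j) ^ 2 else -(L (y - p) j)) := by
    rw [Finset.mul_sum, Finset.mul_sum, ← Finset.sum_add_distrib, hz]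
    refine Finset.sum_le_sum fun j _ => ?_
    simp only [Pi.add_apply, Pi.smul_apply, smul_eq_mul]
    split_ifs
    · exact (even_two.convexOn_pow (𝕜 := ℝ)).2 (mem_univ _) (mem_univ _) hs ht hst
    · linarith
  have := mul_le_mul_of_nonneg_left hsum hb.le
  simp only [modelFn, smul_eq_mul]
  obtain rfl : s = 1 - t := by linarith
  linarith

/-- If `α > a` at the points where all the last coordinates vanish, then suitable scaling
makes the model function smaller than `α` at all the given points. -/
theorem exists_modelFn_lt {n N : ℕ} {φ : Fin N → ((Fin n → ℝ) →ₗ[ℝ] ℝ)} {I : Finset (Fin N)}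
    (h : LinearIndependent ℝ (fun i : I => φ i.1)) {κ : Type*} [Finite κ] (p : Fin n → ℝ) (a : ℝ)
    (x : κ → (Fin n → ℝ)) (α : κ → ℝ) (hx : ∀ k, ∀ i ∈ I, φ i (x k) ≤ φ i p)
    (hα : ∀ k, (∀ i ∈ I, φ i (x k) = φ i p) → a < α k) :
    ∃ L, ∃ c > 0, ∃ b > 0, IsFaceCoord φ I c L ∧
      ∀ k, modelFn (n - I.card) L p a b (x k) < α k := by
  obtain ⟨L, hL⟩ := exists_isFaceCoord_one φ I h
  let P : κ → ℝ := fun k =>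
    ∑ j : Fin n, if (j : ℕ) < n - I.card then (L (x k - p) j) ^ 2 else 0
  let R : κ → ℝ := fun k => ∑ j : Fin n, if (j : ℕ) < n - I.card then 0 else L (x k - p) j
  have hRnn : ∀ k (j : Fin n), 0 ≤ if (j : ℕ) < n - I.card then 0 else L (x k - p) j := by
    intro k j
    split_ifs with hj
    · exact le_rfl
    · obtain ⟨i, hi, hLi⟩ := hL.1 j hj
      rw [hLi, map_sub]
      linarith [hx k i hi]
  have hR0 : ∀ k, 0 ≤ R k := fun k => Finset.sum_nonneg fun j _ => hRnn k j
  have hR : ∀ k, R k = 0 → a < α k := by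
    intro k hk
    refine hα k fun i hi => ?_
    obtain ⟨j, hj, hLj⟩ := hL.2 i hi
    have := (Finset.sum_eq_zero_iff_of_nonneg fun j _ => hRnn k j).1 hk j (Finset.mem_univ j)
    rw [if_neg hj, hLj, map_sub] at this
    linarith
  obtain ⟨b, hb', hb⟩ : ∃ b, (∀ k, R k = 0 → a + b * P k < α k) ∧ 0 < b := by
    have : ∀ᶠ b in 𝓝[>] (0 : ℝ), ∀ k, R k = 0 → a + b * P k < α k := by
      refine eventually_all.2 fun k => ?_
      by_cases hk : R k = 0
      · have ht : Tendsto (fun b : ℝ => a + b * P k) (𝓝[>] 0) (𝓝 (a + 0 * P k)) :=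
          (tendsto_const_nhds.add (tendsto_id.mul_const _)).mono_left nhdsWithin_le_nhds
        filter_upwards [ht.eventually_lt_const (by simpa using hR k hk)] with b hb _ using hb
      · simp [hk]
    exact (this.and self_mem_nhdsWithin).exists
  obtain ⟨c, hc', hc⟩ : ∃ c, (∀ k, a + b * (P k - c * R k) < α k) ∧ 0 < c := by
    have : ∀ᶠ c in atTop, ∀ k, a + b * (P k - c * R k) < α k := by
      refine eventually_all.2 fun k => ?_
      by_cases hk : R k = 0
      · exact Eventually.of_forall fun c => by simpa [hk] using hb' k hk
      · have hbR : 0 < b * R k := mul_pos hb ((hR0 k).lt_of_ne' hk)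
        filter_upwards [eventually_gt_atTop ((a + b * P k - α k) / (b * R k))] with c hc
        rw [div_lt_iff₀ hbR] at hc
        linarith
    exact (this.and (eventually_gt_atTop 0)).exists
  obtain ⟨L', hL', hL'v⟩ := hL.exists_scale hc
  refine ⟨L', c, hc, b, hb, hL', fun k => lt_of_eq_of_lt ?_ (hc' k)⟩
  simp only [modelFn, P, R, Finset.mul_sum, ← Finset.sum_sub_distrib, hL'v]
  congr 1
  refine Finset.sum_congr rfl fun j _ => ?_
  split_ifs <;> ring

/-- The model function is at least its value at `p` along the directions of the face, strictly
away from `p`. -/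
theorem lt_modelFn {n N : ℕ} {φ : Fin N → ((Fin n → ℝ) →ₗ[ℝ] ℝ)} {I : Finset (Fin N)} {c : ℝ}
    {L : (Fin n → ℝ) ≃ₗ[ℝ] (Fin n → ℝ)} (hL : IsFaceCoord φ I c L) (p : Fin n → ℝ) (a : ℝ)
    {b : ℝ} (hb : 0 < b) {u : Fin n → ℝ} (hu : ∀ i ∈ I, φ i u = 0) (hu0 : u ≠ 0) :
    a < modelFn (n - I.card) L p a b (p + u) := by
  have hz : ∀ j : Fin n, ¬ (j : ℕ) < n - I.card → L u j = 0 := fun j hj => by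
    obtain ⟨i, hi, h⟩ := hL.1 j hj
    simp [h, hu i hi]
  have hterm : ∀ j : Fin n, (if (j : ℕ) < n - I.card then (L u j) ^ 2 else -(L u j)) =
      (L u j) ^ 2 := fun j => by
    split_ifs with hj
    · rfl
    · simp [hz j hj]
  obtain ⟨j, hj⟩ : ∃ j, L u j ≠ 0 := Function.ne_iff.1 ((map_ne_zero_iff L L.injective).2 hu0)
  have hsum : 0 < ∑ j : Fin n, (L u j) ^ 2 :=
    Finset.sum_pos' (fun j _ => sq_nonneg _) ⟨j, Finset.mem_univ j, by positivity⟩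
  simp only [modelFn, add_sub_cancel_left, hterm]
  nlinarith [mul_pos hb hsum]

/-- A convex function which is given near `p` by the model function attains its minimum over the
affine span of the face only at `p`. -/
theorem lt_of_eventuallyEq_modelFn {n N : ℕ} {φ : Fin N → ((Fin n → ℝ) →ₗ[ℝ] ℝ)}
    {I : Finset (Fin N)} {c : ℝ} {L : (Fin n → ℝ) ≃ₗ[ℝ] (Fin n → ℝ)} (hL : IsFaceCoord φ I c L)
    {p : Fin n → ℝ} {a b : ℝ} (hb : 0 < b) {f : (Fin n → ℝ) → ℝ} (hfc : ConvexOn ℝ univ f)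
    (hf : f =ᶠ[𝓝 p] modelFn (n - I.card) L p a b) {y : Fin n → ℝ}
    (hy : ∀ i ∈ I, φ i y = φ i p) (hyp : y ≠ p) : a < f y := by
  have hfp : f p = a := by rw [hf.eq_of_nhds, modelFn_self]
  have ht : Tendsto (fun t : ℝ => p + t • (y - p)) (𝓝[>] 0) (𝓝 p) := by
    have : Continuous (fun t : ℝ => p + t • (y - p)) := by fun_prop
    exact Tendsto.mono_left (by simpa using this.tendsto 0) nhdsWithin_le_nhds
  obtain ⟨t, ⟨hft, ht1⟩, ht0⟩ := (((ht.eventually hf).and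
    (nhdsWithin_le_nhds (eventually_lt_nhds (zero_lt_one' ℝ)))).and self_mem_nhdsWithin).exists
  have ht0 : 0 < t := ht0
  have h1 : a < f (p + t • (y - p)) := by
    rw [hft]
    refine lt_modelFn hL p a hb (fun i hi => ?_) (smul_ne_zero ht0.ne' (sub_ne_zero.2 hyp))
    simp [hy i hi]
  have h2 := hfc.2 (mem_univ p) (mem_univ y) (sub_nonneg.2 ht1.le) ht0.le (by ring)
  rw [show (1 - t) • p + t • y = p + t • (y - p) by module, hfp] at h2
  simp only [smul_eq_mul] at h2
  have h3 : 0 < t * (f y - a) := by linarith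
  linarith [pos_of_mul_pos_right h3 ht0.le]

/-- The derivative of a function which is given near `p` by the model function vanishes at `p` in
the directions of the face. -/
theorem fderiv_eq_zero_of_eventuallyEq_modelFn {n N : ℕ} {φ : Fin N → ((Fin n → ℝ) →ₗ[ℝ] ℝ)}
    {I : Finset (Fin N)} {c : ℝ} {L : (Fin n → ℝ) ≃ₗ[ℝ] (Fin n → ℝ)} (hL : IsFaceCoord φ I c L)
    {p : Fin n → ℝ} {a b : ℝ} (hb : 0 < b) {f : (Fin n → ℝ) → ℝ} (hfd : DifferentiableAt ℝ f p)
    (hf : f =ᶠ[𝓝 p] modelFn (n - I.card) L p a b) {u : Fin n → ℝ}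
    (hu : ∀ i ∈ I, φ i u = 0) : fderiv ℝ f p u = 0 := by
  have hd : HasDerivAt (fun t : ℝ => f (p + t • u)) (fderiv ℝ f p u) 0 :=
    hfd.hasFDerivAt.hasLineDerivAt u
  have ht : Tendsto (fun t : ℝ => p + t • u) (𝓝 0) (𝓝 p) := by
    have : Continuous (fun t : ℝ => p + t • u) := by fun_prop
    simpa using this.tendsto 0
  refine IsLocalMin.hasDerivAt_eq_zero (f := fun t : ℝ => f (p + t • u)) ?_ hd
  filter_upwards [ht.eventually hf] with t hft
  rw [hft, zero_smul, add_zero, hf.eq_of_nhds, modelFn_self]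
  by_cases htu : t • u = 0
  · rw [htu, add_zero, modelFn_self]
  · exact (lt_modelFn hL p a hb (fun i hi => by simp [hu i hi]) htu).le

/-- The gradient inequality for convex functions. -/
theorem ConvexOn.add_fderiv_sub_le {E : Type*} [NormedAddCommGroup E] [NormedSpace ℝ E]
    {f : E → ℝ} (hfc : ConvexOn ℝ univ f) {x : E} (hf : DifferentiableAt ℝ f x) (y : E) :
    f x + fderiv ℝ f x (y - x) ≤ f y := by
  have hd : HasDerivAt (fun t : ℝ => f (x + t • (y - x))) (fderiv ℝ f x (y - x)) 0 :=
    hf.hasFDerivAt.hasLineDerivAt (y - x)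
  have hc : ConvexOn ℝ univ (fun t : ℝ => f (x + t • (y - x))) := by
    refine ⟨convex_univ, fun s _ t _ p q hp hq hpq => ?_⟩
    have := hfc.2 (mem_univ (x + s • (y - x))) (mem_univ (x + t • (y - x))) hp hq hpq
    convert this using 2
    obtain rfl : p = 1 - q := by linarith
    simp only [smul_eq_mul]
    module
  have := hc.le_slope_of_hasDerivAt (mem_univ 0) (mem_univ 1) zero_lt_one hd
  simp only [slope_def_field, one_smul, zero_smul, add_sub_cancel, add_zero, sub_zero,
    div_one] at this
  linarith

/-- The affine normal form near a point `p` in the relative interior of the face `F_I`. -/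
theorem exists_normal_form_of_eventuallyEq_modelFn {n N : ℕ}
    {φ : Fin N → ((Fin n → ℝ) →ₗ[ℝ] ℝ)} {lam : Fin N → ℝ} {I : Finset (Fin N)} {c : ℝ}
    (hc : 0 < c) {L : (Fin n → ℝ) ≃ₗ[ℝ] (Fin n → ℝ)} (hL : IsFaceCoord φ I c L)
    {p : Fin n → ℝ} (hp : p ∈ polyRelint φ lam I) {a b : ℝ} {f : (Fin n → ℝ) → ℝ}
    (hf : f =ᶠ[𝓝 p] modelFn (n - I.card) L p a b) :
    ∃ ε > (0 : ℝ), ∃ A : (Fin n → ℝ) ≃ᵃ[ℝ] (Fin n → ℝ),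
      A p = 0 ∧
      ∃ T : Set (Fin n → ℝ),
        T = {z : Fin n → ℝ | ∀ j : Fin n,
              ((j : ℕ) < n - I.card → -ε < z j ∧ z j < ε) ∧
              (n - I.card ≤ (j : ℕ) → 0 ≤ z j ∧ z j < ε)} ∧
        A '' (polyDelta φ lam ∩
            A ⁻¹' {z : Fin n → ℝ | ∀ j : Fin n, -ε < z j ∧ z j < ε}) = T ∧
        ∀ z ∈ T, f (A.symm z) =
          a + b * ∑ j : Fin n,
            (if (j : ℕ) < n - I.card then (z j) ^ 2 else -(z j)) := by
  obtain ⟨-, hpI, hpN⟩ := hp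
  let A : (Fin n → ℝ) ≃ᵃ[ℝ] (Fin n → ℝ) :=
    (AffineEquiv.constVAdd ℝ (Fin n → ℝ) (-p)).trans L.toAffineEquiv
  have hA : ∀ x, A x = L (x - p) := fun x => by
    simp [A, sub_eq_neg_add]
  have hAp : A p = 0 := by simp [hA]
  have hAs : A.symm 0 = p := by rw [← hAp, A.symm_apply_apply]
  have hcont : Continuous A.symm := A.symm.continuous_of_finiteDimensional
  have hlim : Tendsto A.symm (𝓝 0) (𝓝 p) := by simpa [hAs] using hcont.tendsto 0
  have hev : ∀ᶠ x in 𝓝 p, ∀ i, i ∉ I → φ i x < lam i := by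
    refine eventually_all.2 fun i => ?_
    by_cases hi : i ∈ I
    · simp [hi]
    · have : Continuous (φ i) := (φ i).continuous_of_finiteDimensional
      filter_upwards [this.continuousAt.eventually_lt_const (hpN i hi)] with x hx _ using hx
  obtain ⟨ε, hε, hball⟩ := Metric.eventually_nhds_iff_ball.1 (hlim.eventually (hf.and hev))
  have hcube : ∀ z : Fin n → ℝ, (∀ j, -ε < z j ∧ z j < ε) ↔ z ∈ Metric.ball 0 ε := fun z => by
    simp [pi_norm_lt_iff hε, abs_lt]
  have hface : ∀ j : Fin n, n - I.card ≤ (j : ℕ) → ∃ i ∈ I, ∀ x, A x j = c * (lam i - φ i x) :=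
    fun j hj => by
      obtain ⟨i, hi, h⟩ := hL.1 j hj.not_gt
      refine ⟨i, hi, fun x => ?_⟩
      rw [hA, h, map_sub, hpI i hi]
      ring
  have hT : ∀ z : Fin n → ℝ, (∀ j : Fin n,
      ((j : ℕ) < n - I.card → -ε < z j ∧ z j < ε) ∧
      (n - I.card ≤ (j : ℕ) → 0 ≤ z j ∧ z j < ε)) → z ∈ Metric.ball 0 ε := fun z hz => by
    refine (hcube z).1 fun j => ?_
    rcases lt_or_ge (j : ℕ) (n - I.card) with hj | hj
    · exact (hz j).1 hj
    · obtain ⟨h1, h2⟩ := (hz j).2 hj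
      exact ⟨by linarith, h2⟩
  refine ⟨ε, hε, A, hAp, _, rfl, ?_, fun z hz => ?_⟩
  · ext z
    constructor
    · rintro ⟨x, ⟨hx, hxε⟩, rfl⟩ j
      refine ⟨fun _ => hxε j, fun hj => ⟨?_, (hxε j).2⟩⟩
      obtain ⟨i, -, h⟩ := hface j hj
      rw [h]
      exact mul_nonneg hc.le (sub_nonneg.2 (hx i))
    · intro hz
      have hzε := hT z hz
      refine ⟨A.symm z, ⟨fun i => ?_, ?_⟩, A.apply_symm_apply z⟩
      · by_cases hi : i ∈ I
        · obtain ⟨j, hj, h⟩ := hL.2 i hi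
          have h1 := ((hz j).2 (not_lt.1 hj)).1
          rw [← A.apply_symm_apply z, hA, h, map_sub, hpI i hi] at h1
          have h2 : 0 ≤ c * (lam i - φ i (A.symm z)) := by linarith
          exact sub_nonneg.1 (nonneg_of_mul_nonneg_right h2 hc)
        · exact ((hball z hzε).2 i hi).le
      · rw [mem_preimage, A.apply_symm_apply]
        exact (hcube z).2 hzε
  · rw [(hball z (hT z hz)).1, modelFn, ← hA, A.apply_symm_apply]

end AuxiliaryLemmas

/-- **Proposition A.1(A)+(B)+(C).** Let `Δ ⊆ ℝⁿ` be a compact polytope with nonempty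
interior whose presentation is simple and exact, with prescribed data `(x_I, α_I)`.
There is a smooth `f : ℝⁿ → ℝ` with unique prescribed minimum `x_I` (of value `α_I`)
and no other critical points on each face, and such that near each `x_I` (with
`ℓ = n - |I|`) there are affine coordinates, given by an affine automorphism `A` of
`ℝⁿ` taking `x_I` to `0` and a neighbourhood of `x_I` in `Δ` onto
`(-ε,ε)^ℓ × [0,ε)^{n-ℓ}`, in which
`f = α_I + b·(∑_{j<ℓ} z_j² - ∑_{j≥ℓ} z_j)` for some `b > 0`. -/
theorem exists_smooth_function_prescribed_critical_points_local_normal_form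
    {n N : ℕ} (hn : 0 < n) (hN : 0 < N)
    (φ : Fin N → ((Fin n → ℝ) →ₗ[ℝ] ℝ)) (lam : Fin N → ℝ)
    (hcpt : IsCompact (polyDelta φ lam))
    (hint : (interior (polyDelta φ lam)).Nonempty)
    (hsimple : SimplePresentation φ lam)
    (hexact : ExactPresentation φ lam)
    (xpt : Finset (Fin N) → (Fin n → ℝ)) (α : Finset (Fin N) → ℝ)
    (hxpt : ∀ I, (polyFace φ lam I).Nonempty → xpt I ∈ polyRelint φ lam I)
    (hα0 : ∀ I, (polyFace φ lam I).Nonempty → 0 ≤ α I)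
    (hαlt : ∀ I J : Finset (Fin N), I ⊂ J → (polyFace φ lam J).Nonempty → α I < α J) :
    ∃ f : (Fin n → ℝ) → ℝ, ContDiff ℝ (⊤ : ℕ∞) f ∧
      (∀ I : Finset (Fin N), (polyFace φ lam I).Nonempty →
        f (xpt I) = α I ∧
        (∀ y ∈ polyFace φ lam I, f (xpt I) ≤ f y) ∧
        (∀ y ∈ polyFace φ lam I, f y = f (xpt I) → y = xpt I) ∧
        ∀ x ∈ polyRelint φ lam I,
          ((∀ u : Fin n → ℝ, (∀ i ∈ I, φ i u = 0) → fderiv ℝ f x u = 0) ↔ x = xpt I)) ∧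
      ∀ I : Finset (Fin N), (polyFace φ lam I).Nonempty →
        ∃ ε > (0 : ℝ), ∃ b > (0 : ℝ), ∃ A : (Fin n → ℝ) ≃ᵃ[ℝ] (Fin n → ℝ),
          A (xpt I) = 0 ∧
          ∃ T : Set (Fin n → ℝ),
            T = {z : Fin n → ℝ | ∀ j : Fin n,
                  ((j : ℕ) < n - I.card → -ε < z j ∧ z j < ε) ∧
                  (n - I.card ≤ (j : ℕ) → 0 ≤ z j ∧ z j < ε)} ∧
            A '' (polyDelta φ lam ∩
                A ⁻¹' {z : Fin n → ℝ | ∀ j : Fin n, -ε < z j ∧ z j < ε}) = T ∧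
            ∀ z ∈ T, f (A.symm z) =
              α I + b * ∑ j : Fin n,
                (if (j : ℕ) < n - I.card then (z j) ^ 2 else -(z j)) := by
  have hlin : ∀ I, (polyFace φ lam I).Nonempty → LinearIndependent ℝ (fun i : I => φ i.1) := by
    intro I hI
    obtain ⟨hΔ, hpI, -⟩ := hxpt I hI
    exact (hsimple _ hΔ).comp (fun i : I => ⟨i.1, hpI i.1 i.2⟩)
      fun i j hij => Subtype.ext (Subtype.mk.inj hij)
  let V := {I : Finset (Fin N) // (polyFace φ lam I).Nonempty}
  have hmodel : ∀ I : V, ∃ L, ∃ c > 0, ∃ b > 0, IsFaceCoord φ I.1 c L ∧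
      ∀ k : {K : V // K ≠ I},
        modelFn (n - I.1.card) L (xpt I.1) (α I.1) b (xpt k.1.1) < α k.1.1 := by
    intro I
    obtain ⟨-, hpI, -⟩ := hxpt I.1 I.2
    refine exists_modelFn_lt (hlin I.1 I.2) _ _ (fun k : {K : V // K ≠ I} => xpt k.1.1)
      (fun k => α k.1.1) (fun k i hi => ?_) fun k hk => ?_
    · rw [hpI i hi]
      exact (hxpt k.1.1 k.1.2).1 i
    · refine hαlt _ _ (Finset.ssubset_iff_subset_ne.2 ⟨fun i hi => ?_, fun h => ?_⟩) k.1.2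
      · by_contra hik
        have := (hxpt k.1.1 k.1.2).2.2 i hik
        rw [hk i hi, hpI i hi] at this
        exact this.false
      · exact k.2 (Subtype.ext h.symm)
  choose L c hc b hb hL hlt using hmodel
  obtain ⟨f, hf, hfc, hfeq⟩ := exists_smooth_convex_eventuallyEq (fun I : V => xpt I.1)
    (fun I => modelFn (n - I.1.card) (L I) (xpt I.1) (α I.1) (b I))
    (fun I => contDiff_modelFn _ _ _ _ _) (fun I => convexOn_modelFn _ _ _ _ (hb I))
    fun I K hIK => by
      rw [modelFn_self]
      exact hlt I ⟨K, hIK.symm⟩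
  have hfd : Differentiable ℝ f := hf.differentiable (by simp)
  refine ⟨f, hf, fun I hI => ?_, fun I hI => ?_⟩
  · have hfI := hfeq ⟨I, hI⟩
    have hval : f (xpt I) = α I := by rw [hfI.eq_of_nhds, modelFn_self]
    have hstrict : ∀ y ∈ polyFace φ lam I, y ≠ xpt I → f (xpt I) < f y := fun y hy hne => by
      rw [hval]
      refine lt_of_eventuallyEq_modelFn (hL ⟨I, hI⟩) (hb _) hfc hfI (fun i hi => ?_) hne
      rw [hy.2 i hi, (hxpt I hI).2.1 i hi]
    refine ⟨hval, fun y hy => ?_, fun y hy hfy => ?_, fun x hx => ⟨fun hcrit => ?_, ?_⟩⟩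
    · rcases eq_or_ne y (xpt I) with rfl | hne
      · exact le_rfl
      · exact (hstrict y hy hne).le
    · by_contra hne
      exact (hstrict y hy hne).ne' hfy
    · by_contra hne
      have h1 := hstrict x ⟨hx.1, hx.2.1⟩ hne
      have h2 := hfc.add_fderiv_sub_le (hfd x) (xpt I)
      rw [hcrit _ fun i hi => by rw [map_sub, hx.2.1 i hi, (hxpt I hI).2.1 i hi, sub_self]] at h2
      linarith
    · rintro rfl u hu
      exact fderiv_eq_zero_of_eventuallyEq_modelFn (hL ⟨I, hI⟩) (hb _) (hfd _) hfI hu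
  · obtain ⟨ε, hε, A, hA⟩ := exists_normal_form_of_eventuallyEq_modelFn (hc ⟨I, hI⟩)
      (hL ⟨I, hI⟩) (hxpt I hI) (hfeq ⟨I, hI⟩)
    exact ⟨ε, hε, b ⟨I, hI⟩, hb _, A, hA⟩
end
end

section
/- Assume the presentation of the compact polytope Δ ⊆ ℝ^n is simple and exact, and suppose given, for each I ⊆ {1,…,N} with F_I nonempty, a point x_I ∈ relint F_I. Then there exist smooth maps ξ_1, …, ξ_N : ℝ^n → ℝ^n such that: (1) φ_i(ξ_i(x)) < 0 for every i and every x in the facet σ_i = F_{{i}}; (2) φ_j(ξ_i(x)) = 0 whenever i ≠ j and x ∈ σ_i ∩ σ_j; and (3) for every I with F_I nonempty and every i ∈ I, the map ξ_i is constant on some neighborhood of x_I in ℝ^n. -/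
noncomputable section

open Filter Set Topology

/-- A convex-valued map on a finite-dimensional space that locally admits constant selections has a
smooth selection that is locally constant at finitely many prescribed points. -/
theorem exists_contDiff_forall_mem_convex_eventually_const {E F : Type*}
    [NormedAddCommGroup E] [NormedSpace ℝ E] [FiniteDimensional ℝ E]
    [NormedAddCommGroup F] [NormedSpace ℝ F] {t : E → Set F} (ht : ∀ x, Convex ℝ (t x))
    (hloc : ∀ x, ∃ c : F, ∀ᶠ y in 𝓝 x, c ∈ t y) {S : Set E} (hS : S.Finite) :
    ∃ g : E → F, ContDiff ℝ (⊤ : ℕ∞) g ∧ (∀ x, g x ∈ t x) ∧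
      ∀ p ∈ S, ∃ c : F, ∀ᶠ y in 𝓝 p, g y = c := by
  induction S, hS using Set.Finite.induction_on with
  | empty =>
    obtain ⟨g, hg⟩ := exists_contMDiffMap_forall_mem_convex_of_local_const
      (n := ⊤) (modelWithCornersSelf ℝ E) ht hloc
    exact ⟨g, g.contMDiff.contDiff, hg, by simp⟩
  | @insert p S hp hS ih =>
    obtain ⟨g, hg, hgt, hgS⟩ := ih
    obtain ⟨c, hc⟩ := hloc p
    obtain ⟨r, hr, hrsub⟩ := Metric.nhds_basis_closedBall.mem_iff.1
      (inter_mem hc (hS.isClosed.isOpen_compl.mem_nhds hp))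
    let b : ContDiffBump p := ⟨r / 2, r, half_pos hr, half_lt_self hr⟩
    refine ⟨fun x => (1 - b x) • g x + b x • c, ?_, fun x => ?_, ?_⟩
    · exact ((contDiff_const.sub b.contDiff).smul hg).add (b.contDiff.smul contDiff_const)
    · by_cases hx : x ∈ Metric.closedBall p r
      · exact ht x (hgt x) (hrsub hx).1 (sub_nonneg.2 b.le_one) b.nonneg (sub_add_cancel _ _)
      · have hbx : b x = 0 := b.zero_of_le_dist (le_of_lt (by simpa using hx))
        simpa [hbx] using hgt x
    · rintro q (rfl | hq)
      · refine ⟨c, ?_⟩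
        filter_upwards [b.eventuallyEq_one] with y hy
        simp [hy]
      · obtain ⟨d, hd⟩ := hgS q hq
        refine ⟨d, ?_⟩
        have hqr : q ∉ Metric.closedBall p r := fun h => (hrsub h).2 hq
        filter_upwards [hd, Metric.isClosed_closedBall.isOpen_compl.mem_nhds hqr] with y hy hyr
        have hby : b y = 0 := b.zero_of_le_dist (le_of_lt (by simpa using hyr))
        simp [hby, hy]

/-- For finitely many linearly independent functionals, each one is negative at some common zero of
the others. -/
theorem LinearIndependent.exists_dual_neg_of_forall_ne_eq_zero {ι V : Type*} [Finite ι]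
    [AddCommGroup V] [Module ℝ V] {f : ι → V →ₗ[ℝ] ℝ} (hf : LinearIndependent ℝ f) (i : ι) :
    ∃ v : V, f i v < 0 ∧ ∀ j, j ≠ i → f j v = 0 := by
  have hspan : f i ∉ Submodule.span ℝ (range fun j : {j // j ≠ i} => f j) := by
    have h := hf.notMem_span_image (s := {j | j ≠ i}) (x := i) (by simp)
    rwa [image_eq_range] at h
  obtain ⟨v, hv, hvi⟩ := SetLike.not_le_iff_exists.1 (mt mem_span_of_iInf_ker_le_ker hspan)
  simp only [Submodule.mem_iInf, LinearMap.mem_ker, Subtype.forall] at hv hvi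
  rcases lt_or_gt_of_ne hvi with h | h
  · exact ⟨v, h, hv⟩
  · exact ⟨-v, by simpa using h, fun j hj => by simp [hv j hj]⟩

/-- The directions at `x` that point strictly inward along the `i`-th facet and are tangent to the
other facets through `x`; there is no constraint off the `i`-th facet. -/
def inwardDirections {n N : ℕ} (φ : Fin N → ((Fin n → ℝ) →ₗ[ℝ] ℝ)) (lam : Fin N → ℝ)
    (i : Fin N) (x : Fin n → ℝ) : Set (Fin n → ℝ) :=
  {v | x ∈ polyFace φ lam {i} → φ i v < 0 ∧ ∀ j, j ≠ i → φ j x = lam j → φ j v = 0}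

theorem convex_inwardDirections {n N : ℕ} (φ : Fin N → ((Fin n → ℝ) →ₗ[ℝ] ℝ))
    (lam : Fin N → ℝ) (i : Fin N) (x : Fin n → ℝ) :
    Convex ℝ (inwardDirections φ lam i x) := by
  intro v hv w hw a b ha hb hab hx
  refine ⟨convex_halfSpace_lt (φ i).isLinear 0 (hv hx).1 (hw hx).1 ha hb hab, fun j hj hjx => ?_⟩
  simp [(hv hx).2 j hj hjx, (hw hx).2 j hj hjx]

theorem SimplePresentation.exists_eventually_mem_inwardDirections {n N : ℕ}
    {φ : Fin N → ((Fin n → ℝ) →ₗ[ℝ] ℝ)} {lam : Fin N → ℝ} (h : SimplePresentation φ lam)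
    (i : Fin N) (x : Fin n → ℝ) :
    ∃ c, ∀ᶠ y in 𝓝 x, c ∈ inwardDirections φ lam i y := by
  have hcont (j : Fin N) : Continuous (φ j) := (φ j).continuous_of_finiteDimensional
  by_cases hx : x ∈ polyFace φ lam {i}
  · have hix : φ i x = lam i := hx.2 i (Finset.mem_singleton_self i)
    obtain ⟨v, hvi, hv⟩ := (h x hx.1).exists_dual_neg_of_forall_ne_eq_zero ⟨i, hix⟩
    have hactive : ∀ᶠ y in 𝓝 x, ∀ j, φ j x ≠ lam j → φ j y ≠ lam j :=
      eventually_all.2 fun j => eventually_imp_distrib_left.2 fun hj =>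
        (hcont j).continuousAt.eventually_ne hj
    refine ⟨v, hactive.mono fun y hy _ => ⟨hvi, fun j hj hjy => ?_⟩⟩
    have hjx : φ j x = lam j := not_imp_not.1 (hy j) hjy
    exact hv ⟨j, hjx⟩ fun he => hj (congrArg Subtype.val he)
  · have hclosed : IsClosed (polyFace φ lam {i}) := by
      simp only [polyFace, polyDelta, Finset.mem_singleton, forall_eq, ofPred_and,
        ofPred_forall]
      exact (isClosed_iInter fun j => isClosed_le (hcont j) continuous_const).inter
        (isClosed_eq (hcont i) continuous_const)
    exact ⟨0, (hclosed.isOpen_compl.eventually_mem hx).mono fun y hy hface => absurd hface hy⟩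

/-- **Lemma A.2.** Let `Δ ⊆ ℝⁿ` be a compact polytope with nonempty interior whose
presentation is simple and exact, with a chosen point `x_I ∈ relint F_I` for each
nonempty face `F_I`.  Then there are smooth vector fields `ξ_1, …, ξ_N : ℝⁿ → ℝⁿ` such
that `ξ_i` points transversally into `Δ` along the facet `σ_i = F_{i}` (i.e.
`φ i (ξ i x) < 0` there), `ξ_i` is tangent to every other facet it meets (i.e.
`φ j (ξ i x) = 0` on `σ_i ∩ σ_j` for `j ≠ i`), and for each nonempty face `F_I` and
each `i ∈ I` the vector field `ξ_i` is constant on a neighbourhood of `x_I`. -/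
theorem exists_inward_vector_fields_along_facets
    {n N : ℕ} (hn : 0 < n) (hN : 0 < N)
    (φ : Fin N → ((Fin n → ℝ) →ₗ[ℝ] ℝ)) (lam : Fin N → ℝ)
    (hcpt : IsCompact (polyDelta φ lam))
    (hint : (interior (polyDelta φ lam)).Nonempty)
    (hsimple : SimplePresentation φ lam)
    (hexact : ExactPresentation φ lam)
    (xpt : Finset (Fin N) → (Fin n → ℝ))
    (hxpt : ∀ I, (polyFace φ lam I).Nonempty → xpt I ∈ polyRelint φ lam I) :
    ∃ ξ : Fin N → (Fin n → ℝ) → (Fin n → ℝ),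
      (∀ i, ContDiff ℝ (⊤ : ℕ∞) (ξ i)) ∧
      (∀ i, ∀ x ∈ polyFace φ lam {i}, φ i (ξ i x) < 0) ∧
      (∀ i j, i ≠ j →
        ∀ x ∈ polyFace φ lam {i} ∩ polyFace φ lam {j}, φ j (ξ i x) = 0) ∧
      ∀ I : Finset (Fin N), (polyFace φ lam I).Nonempty → ∀ i ∈ I,
        ∃ U : Set (Fin n → ℝ), IsOpen U ∧ xpt I ∈ U ∧
          ∃ c : Fin n → ℝ, ∀ y ∈ U, ξ i y = c := by
  choose ξ hξ hmem hconst using fun i => exists_contDiff_forall_mem_convex_eventually_const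
    (convex_inwardDirections φ lam i) (hsimple.exists_eventually_mem_inwardDirections i)
    (finite_range xpt)
  refine ⟨ξ, hξ, fun i x hx => (hmem i x hx).1, fun i j hij x hx => ?_, fun I _ i _ => ?_⟩
  · exact (hmem i x hx.1).2 j hij.symm (hx.2.2 j (Finset.mem_singleton_self j))
  · obtain ⟨c, hc⟩ := hconst i (xpt I) (mem_range_self I)
    obtain ⟨U, hUc, hU, hxU⟩ := eventually_nhds_iff.1 hc
    exact ⟨U, hU, hxU, c, hUc⟩
end
end

section
/- Fix an integer ℓ ≥ 1, a finite index set K, and linear functionals L_k (k ∈ K) on ℝ^ℓ; let F = {x ∈ ℝ^ℓ : L_k(x) ≤ 1 for all k ∈ K} be compact with 0 in its interior, and for δ ∈ (0,1) set F_δ = {x : L_k(x) ≤ 1 − δ for all k}. Let f be a smooth function defined on an open set W ⊆ ℝ^ℓ containing ∂F = {x ∈ F : L_k(x) = 1 for some k}, and suppose that for every x ∈ ∂F there exists a vector u ∈ ℝ^ℓ with Df_x(u) < 0 and L_k(u) < 0 for every k ∈ K with L_k(x) = 1. Then there exist an open set V with F ⊆ V ⊆ ℝ^ℓ, a constant δ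 ∈ (0,1), and a smooth map η : V ∖ {0} → ℝ^ℓ such that: (1) for every k ∈ K and every x ∈ V ∖ {0} with 1 − δ ≤ L_k(x) ≤ 1, one has L_k(η(x)) < −δ; (2) η(x) = −x/‖x‖ for every x ∈ F_δ ∖ {0}; and (3) Df_x(η(x)) < 0 for every x ∈ ∂F. -/
noncomputable section

/-- The compact polytope `F = {x ∈ ℝ^ℓ : L k x ≤ 1 for all k}`. -/
def polyF {ℓ : ℕ} {K : Type*} (L : K → (EuclideanSpace ℝ (Fin ℓ) →ₗ[ℝ] ℝ)) :
    Set (EuclideanSpace ℝ (Fin ℓ)) :=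
  {x | ∀ k, L k x ≤ 1}

/-- The boundary `∂F = {x ∈ F : L k x = 1 for some k}`. -/
def polyBdry {ℓ : ℕ} {K : Type*} (L : K → (EuclideanSpace ℝ (Fin ℓ) →ₗ[ℝ] ℝ)) :
    Set (EuclideanSpace ℝ (Fin ℓ)) :=
  {x ∈ polyF L | ∃ k, L k x = 1}

open Set Filter Topology
open scoped Pointwise Manifold

theorem continuous_polyFunctional {ℓ : ℕ} {K : Type*}
    (L : K → (EuclideanSpace ℝ (Fin ℓ) →ₗ[ℝ] ℝ)) (k : K) : Continuous (L k) :=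
  (L k).continuous_of_finiteDimensional

theorem isClosed_setOf_forall_le {ℓ : ℕ} {K : Type*}
    (L : K → (EuclideanSpace ℝ (Fin ℓ) →ₗ[ℝ] ℝ)) (c : ℝ) : IsClosed {x | ∀ k, L k x ≤ c} := by
  simp only [ofPred_forall]
  exact isClosed_iInter fun k => isClosed_le (continuous_polyFunctional L k) continuous_const

theorem isClosed_polyBdry {ℓ : ℕ} {K : Type*} [Finite K]
    (L : K → (EuclideanSpace ℝ (Fin ℓ) →ₗ[ℝ] ℝ)) : IsClosed (polyBdry L) := by
  have h : polyBdry L = polyF L ∩ ⋃ k, {x | L k x = 1} := by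
    ext x
    simp [polyBdry]
  rw [h]
  exact (isClosed_setOf_forall_le L 1).inter
    (isClosed_iUnion_of_finite fun k => isClosed_eq (continuous_polyFunctional L k) continuous_const)

/-- Pointwise descent directions on `∂F` can be chosen smoothly. -/
theorem exists_contDiff_descent {ℓ : ℕ} {K : Type*} [Finite K]
    (L : K → (EuclideanSpace ℝ (Fin ℓ) →ₗ[ℝ] ℝ))
    (D : EuclideanSpace ℝ (Fin ℓ) → (EuclideanSpace ℝ (Fin ℓ) →L[ℝ] ℝ))
    (hD : ∀ x ∈ polyBdry L, ContinuousAt D x)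
    (hdec : ∀ x ∈ polyBdry L, ∃ u, D x u < 0 ∧ ∀ k, L k x = 1 → L k u < 0) :
    ∃ ξ : EuclideanSpace ℝ (Fin ℓ) → EuclideanSpace ℝ (Fin ℓ), ContDiff ℝ (⊤ : ℕ∞) ξ ∧
      ∀ x ∈ polyBdry L, D x (ξ x) < 0 ∧ ∀ k, L k x = 1 → L k (ξ x) < 0 := by
  let t : EuclideanSpace ℝ (Fin ℓ) → Set (EuclideanSpace ℝ (Fin ℓ)) := fun x =>
    {v | x ∈ polyBdry L → D x v < 0 ∧ ∀ k, L k x = 1 → L k v < 0}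
  have hconv : ∀ x, Convex ℝ (t x) := by
    have hneg : ∀ a b p q : ℝ, 0 ≤ a → 0 ≤ b → a + b = 1 → p < 0 → q < 0 →
        a * p + b * q < 0 := fun a b p q ha hb hab hp hq =>
      convex_Iio (0 : ℝ) hp hq ha hb hab
    intro x v hv w hw a b ha hb hab hx
    obtain ⟨hv₁, hv₂⟩ := hv hx
    obtain ⟨hw₁, hw₂⟩ := hw hx
    refine ⟨?_, fun k hk => ?_⟩
    · simpa using hneg a b _ _ ha hb hab hv₁ hw₁
    · simpa using hneg a b _ _ ha hb hab (hv₂ k hk) (hw₂ k hk)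
  have hloc : ∀ x, ∃ c, ∀ᶠ y in 𝓝 x, c ∈ t y := by
    intro x
    by_cases hx : x ∈ polyBdry L
    · obtain ⟨u, hu, huL⟩ := hdec x hx
      refine ⟨u, ?_⟩
      have h₁ : ∀ᶠ y in 𝓝 x, D y u < 0 :=
        ((hD x hx).clm_apply continuousAt_const).eventually_lt continuousAt_const hu
      have h₂ : ∀ᶠ y in 𝓝 x, ∀ k, L k y = 1 → L k u < 0 := by
        refine eventually_all.2 fun k => ?_
        by_cases hk : L k x = 1
        · exact Eventually.of_forall fun _ _ => huL k hk
        · filter_upwards [(continuous_polyFunctional L k).continuousAt.eventually_ne hk] with y hy h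
          exact absurd h hy
      filter_upwards [h₁, h₂] with y hy₁ hy₂ _ using ⟨hy₁, hy₂⟩
    · refine ⟨0, ?_⟩
      filter_upwards [(isClosed_polyBdry L).isOpen_compl.mem_nhds hx] with y hy h
      exact absurd h hy
  obtain ⟨g, hg⟩ := exists_contMDiffMap_forall_mem_convex_of_local_const
    (n := (⊤ : ℕ∞)) 𝓘(ℝ, EuclideanSpace ℝ (Fin ℓ)) hconv hloc
  exact ⟨g, g.contMDiff.contDiff, hg⟩

/-- A continuous field pointing strictly inward on `∂F` points uniformly inward near each facet. -/
theorem eventually_uniformly_inward {ℓ : ℕ} {K : Type*} [Finite K]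
    (L : K → (EuclideanSpace ℝ (Fin ℓ) →ₗ[ℝ] ℝ)) {S : Set (EuclideanSpace ℝ (Fin ℓ))}
    (hS : IsCompact S) {ξ : EuclideanSpace ℝ (Fin ℓ) → EuclideanSpace ℝ (Fin ℓ)}
    (hξ : Continuous ξ) (hin : ∀ x ∈ polyF L, ∀ k, L k x = 1 → L k (ξ x) < 0) :
    ∀ᶠ δ in 𝓝 (0 : ℝ), ∀ x ∈ S, ∀ k, (∀ j, L j x < 1 + δ) → 1 - δ ≤ L k x →
      L k (ξ x) < -δ := by
  refine hS.eventually_forall_of_forall_eventually fun x _ => eventually_all.2 fun k => ?_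
  have hL := continuous_polyFunctional L
  have hLsnd : ∀ j, Continuous fun z : ℝ × EuclideanSpace ℝ (Fin ℓ) => L j z.2 :=
    fun j => (hL j).comp continuous_snd
  by_cases hx : x ∈ polyF L
  · by_cases hk : L k x = 1
    · have h := (((hL k).comp (hξ.comp continuous_snd)).continuousAt
        (x := ((0 : ℝ), x))).eventually_lt continuous_fst.neg.continuousAt
        (by simpa using hin x hx k hk)
      exact h.mono fun z hz _ _ => hz
    · have h := ((hLsnd k).continuousAt (x := ((0 : ℝ), x))).eventually_lt
        (continuous_const.sub continuous_fst).continuousAt (g := fun z => 1 - z.1)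
        (by simpa using lt_of_le_of_ne (hx k) hk)
      exact h.mono fun z hz _ hz' => absurd hz' (not_le.2 hz)
  · obtain ⟨j, hj⟩ : ∃ j, 1 < L j x := by simpa [polyF] using hx
    have h := ContinuousAt.eventually_lt (f := fun z => 1 + z.1)
      (continuous_const.add continuous_fst).continuousAt
      ((hLsnd j).continuousAt (x := ((0 : ℝ), x))) (by simpa using hj)
    exact h.mono fun z hz hz' _ => absurd (hz' j) (not_lt.2 hz.le)

/-- The unit inward radial field is smooth away from the origin. -/
theorem contDiffOn_neg_normalize {E : Type*} [NormedAddCommGroup E] [InnerProductSpace ℝ E]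
    {n : WithTop ℕ∞} : ContDiffOn ℝ n (fun x : E => -(‖x‖⁻¹ • x)) {0}ᶜ := fun _ hx =>
  ((((contDiffAt_norm ℝ hx).inv (norm_ne_zero_iff.2 hx)).smul
    contDiffAt_id).neg).contDiffWithinAt

/-- **Lemma A.3.**  Let `F = {x : L k x ≤ 1}` be compact with `0` in its interior, and
let `f` be smooth on an open set `W ⊇ ∂F` such that at every `x ∈ ∂F` there is a
vector `u` with `Df_x(u) < 0` and `L k u < 0` for every active `k`.  Then there are an
open `V ⊇ F`, a constant `δ ∈ (0,1)` and a smooth vector field `η` on `V ∖ {0}` such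
that `L k (η x) < -δ` whenever `1 - δ ≤ L k x ≤ 1`, `η` is the inward unit radial
field `-x/‖x‖` on `F_δ ∖ {0}`, and `Df_x(η x) < 0` for every `x ∈ ∂F`. -/
theorem exists_taming_vector_field
    {ℓ : ℕ} (hℓ : 1 ≤ ℓ) {K : Type*} [Fintype K]
    (L : K → (EuclideanSpace ℝ (Fin ℓ) →ₗ[ℝ] ℝ))
    (hFcpt : IsCompact (polyF L))
    (h0 : (0 : EuclideanSpace ℝ (Fin ℓ)) ∈ interior (polyF L))
    (W : Set (EuclideanSpace ℝ (Fin ℓ))) (hW : IsOpen W) (hbdW : polyBdry L ⊆ W)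
    (f : EuclideanSpace ℝ (Fin ℓ) → ℝ) (hf : ContDiffOn ℝ (⊤ : ℕ∞) f W)
    (hdec : ∀ x ∈ polyBdry L, ∃ u : EuclideanSpace ℝ (Fin ℓ),
      fderiv ℝ f x u < 0 ∧ ∀ k, L k x = 1 → L k u < 0) :
    ∃ V : Set (EuclideanSpace ℝ (Fin ℓ)), IsOpen V ∧ polyF L ⊆ V ∧
      ∃ δ : ℝ, 0 < δ ∧ δ < 1 ∧
        ∃ η : EuclideanSpace ℝ (Fin ℓ) → EuclideanSpace ℝ (Fin ℓ),
          ContDiffOn ℝ (⊤ : ℕ∞) η (V \ {0}) ∧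
          (∀ k, ∀ x ∈ V \ {0}, 1 - δ ≤ L k x → L k x ≤ 1 → L k (η x) < -δ) ∧
          (∀ x : EuclideanSpace ℝ (Fin ℓ),
            (∀ k, L k x ≤ 1 - δ) → x ≠ 0 → η x = -(‖x‖⁻¹ • x)) ∧
          ∀ x ∈ polyBdry L, fderiv ℝ f x (η x) < 0 := by
  have hD : ∀ x ∈ polyBdry L, ContinuousAt (fderiv ℝ f) x := fun x hx =>
    (hf.continuousOn_fderiv_of_isOpen hW (by simp)).continuousAt (hW.mem_nhds (hbdW hx))
  obtain ⟨ξ, hξ, hξdec⟩ := exists_contDiff_descent L (fderiv ℝ f) hD hdec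
  have hS : IsCompact ((2 : ℝ) • polyF L) := hFcpt.smul 2
  obtain ⟨M, hM⟩ := hS.isBounded.exists_norm_le
  have hδM : ∀ᶠ δ in 𝓝 (0 : ℝ), δ * M < 1 - δ :=
    ContinuousAt.eventually_lt (by fun_prop) (by fun_prop) (by simp)
  obtain ⟨δ, ⟨⟨hin, hδM⟩, hδ₁⟩, hδ₀⟩ :=
    ((((eventually_uniformly_inward L hS hξ.continuous
      fun x hx k hk => (hξdec x ⟨hx, k, hk⟩).2 k hk).and hδM).and
      (eventually_lt_nhds one_pos)).filter_mono nhdsWithin_le_nhds |>.and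
      (self_mem_nhdsWithin (s := Ioi (0 : ℝ)))).exists
  replace hδ₀ : 0 < δ := hδ₀
  have hdisj : Disjoint {x | ∀ k, L k x ≤ 1 - δ} (polyBdry L) := by
    rw [disjoint_left]
    rintro x hx ⟨-, k, hk⟩
    have := hx k
    linarith
  obtain ⟨χ, hχ₀, hχ₁, hχ⟩ := exists_contMDiffMap_zero_one_of_isClosed
    (n := (⊤ : ℕ∞)) 𝓘(ℝ, EuclideanSpace ℝ (Fin ℓ))
    (isClosed_setOf_forall_le L (1 - δ)) (isClosed_polyBdry L) hdisj
  have hχs : ContDiff ℝ (⊤ : ℕ∞) χ := χ.contMDiff.contDiff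
  refine ⟨{x | ∀ k, L k x < 1 + δ}, ?_, fun x hx k => by linarith [hx k], δ, hδ₀, hδ₁,
    fun x => (1 - χ x) • (-(‖x‖⁻¹ • x)) + χ x • ξ x, ?_, ?_, ?_, ?_⟩
  · simp only [ofPred_forall]
    exact isOpen_iInter_of_finite fun k =>
      isOpen_lt (continuous_polyFunctional L k) continuous_const
  · exact (((contDiff_const.sub hχs).contDiffOn.smul contDiffOn_neg_normalize).add
      (hχs.smul hξ).contDiffOn).mono fun x hx => hx.2
  · rintro k x ⟨hxV, hx0⟩ hkx -
    have hxS : x ∈ (2 : ℝ) • polyF L := by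
      refine (mem_smul_set_iff_inv_smul_mem₀ two_ne_zero _ _).2 fun j => ?_
      have := hxV j
      rw [map_smul, smul_eq_mul]
      linarith
    have hnorm : 0 < ‖x‖ := norm_pos_iff.2 hx0
    have hrad : L k (-(‖x‖⁻¹ • x)) < -δ := by
      rw [map_neg, map_smul, smul_eq_mul, neg_lt_neg_iff, inv_mul_eq_div, lt_div_iff₀ hnorm]
      linarith [mul_le_mul_of_nonneg_left (hM x hxS) hδ₀.le]
    rw [map_add, map_smul, map_smul]
    exact convex_Iio (-δ) hrad (hin x hxS k hxV hkx) (sub_nonneg.2 (hχ x).2) (hχ x).1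
      (sub_add_cancel _ _)
  · intro x hx _
    have : χ x = 0 := hχ₀ hx
    simp [this]
  · intro x hx
    have : χ x = 1 := hχ₁ hx
    simpa [this] using (hξdec x hx).1
end
end

section
/- Fix an integer ℓ ≥ 1 and real numbers r₂ > r₁ > 0, and let T : ℝ^ℓ → ℝ be a smooth function with T(x) > 0 for all x. Then there exists a smooth function σ : ℝ^ℓ → ℝ with σ(x) > 0 for all x, with σ(x) = 1 whenever ‖x‖ ≤ r₁ or ‖x‖ ≥ r₂, and such that for every x ∈ ℝ^ℓ with ‖x‖ = r₁ one has ∫_{r₁}^{r₂} (1 / σ(r·(x/r₁))) dr = r₂ − r₁ + T(x). -/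
open MeasureTheory

/-- There is a smooth nonnegative function on `ℝ` supported in `(a, b)` with integral `1`. -/
theorem exists_contDiff_support_eq_Ioo_integral_eq_one {a b : ℝ} (hab : a < b) :
    ∃ β : ℝ → ℝ, ContDiff ℝ (⊤ : ℕ∞) β ∧ (∀ r, 0 ≤ β r) ∧ Function.support β = Set.Ioo a b ∧
      ∫ r in a..b, β r = 1 := by
  let φ : ContDiffBump ((a + b) / 2) := ⟨(b - a) / 4, (b - a) / 2, by linarith, by linarith⟩
  have hsupp : Function.support (φ.normed volume) = Set.Ioo a b := by
    rw [φ.support_normed_eq, Real.ball_eq_Ioo]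
    congr 1 <;> simp only [φ] <;> ring
  refine ⟨φ.normed volume, φ.contDiff_normed, φ.nonneg_normed, hsupp, ?_⟩
  rw [intervalIntegral.integral_eq_integral_of_support_subset
    (hsupp.subset.trans Set.Ioo_subset_Ioc_self), φ.integral_normed]

/-- Multiplying the degree-zero homogeneous extension of `T` from the sphere of radius `R` by a
smooth radial cutoff vanishing on `(-∞, a]`, `a > 0`, gives a smooth function. -/
theorem contDiff_radial_cutoff_mul_homogeneous {E : Type*} [NormedAddCommGroup E]
    [InnerProductSpace ℝ E] {n : WithTop ℕ∞} {β : ℝ → ℝ} {T : E → ℝ} {a : ℝ} (R : ℝ)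
    (hβ : ContDiff ℝ n β) (hT : ContDiff ℝ n T) (ha : 0 < a) (hβa : ∀ r ≤ a, β r = 0) :
    ContDiff ℝ n fun x : E => β ‖x‖ * T ((R / ‖x‖) • x) := by
  rw [contDiff_iff_contDiffAt]
  intro x
  rcases eq_or_ne x 0 with rfl | hx
  · refine (contDiffAt_const (c := (0 : ℝ))).congr_of_eventuallyEq ?_
    filter_upwards [Metric.ball_mem_nhds (0 : E) ha] with y hy
    rw [hβa _ (mem_ball_zero_iff.1 hy).le, zero_mul]
  · have hnorm : ContDiffAt ℝ n (fun y : E => ‖y‖) x := contDiffAt_norm ℝ hx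
    exact (hβ.contDiffAt.comp x hnorm).mul (hT.contDiffAt.comp x
      ((contDiffAt_const.div hnorm (norm_ne_zero_iff.2 hx)).smul contDiffAt_id))

/-- **Lemma A.7.**  Fix `ℓ ≥ 1`, radii `0 < r₁ < r₂`, and a smooth positive function
`T : ℝ^ℓ → ℝ`.  There is a smooth positive function `σ : ℝ^ℓ → ℝ`, equal to `1`
outside the annulus `r₁ < ‖x‖ < r₂`, such that for every `x` with `‖x‖ = r₁` the
radial travel time `∫_{r₁}^{r₂} dr / σ(r·(x/r₁))` equals `r₂ - r₁ + T x`. -/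
theorem exists_radial_rescaling_prescribed_travel_time
    {ℓ : ℕ} (hℓ : 1 ≤ ℓ) (r₁ r₂ : ℝ) (hr₁ : 0 < r₁) (hr₁₂ : r₁ < r₂)
    (T : EuclideanSpace ℝ (Fin ℓ) → ℝ) (hT : ContDiff ℝ (⊤ : ℕ∞) T) (hTpos : ∀ x, 0 < T x) :
    ∃ σ : EuclideanSpace ℝ (Fin ℓ) → ℝ, ContDiff ℝ (⊤ : ℕ∞) σ ∧ (∀ x, 0 < σ x) ∧
      (∀ x : EuclideanSpace ℝ (Fin ℓ), ‖x‖ ≤ r₁ ∨ r₂ ≤ ‖x‖ → σ x = 1) ∧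
      ∀ x : EuclideanSpace ℝ (Fin ℓ), ‖x‖ = r₁ →
        (∫ r in r₁..r₂, 1 / σ ((r / r₁) • x)) = r₂ - r₁ + T x := by
  obtain ⟨β, hβ, hβ0, hsupp, hint⟩ := exists_contDiff_support_eq_Ioo_integral_eq_one hr₁₂
  have hβ_eq : ∀ r, r ≤ r₁ ∨ r₂ ≤ r → β r = 0 := fun r hr =>
    Function.notMem_support.1 fun h => by
      rw [hsupp] at h
      exact hr.elim h.1.not_ge h.2.not_ge
  have hpos : ∀ x, 0 < 1 + β ‖x‖ * T ((r₁ / ‖x‖) • x) := fun x =>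
    add_pos_of_pos_of_nonneg one_pos (mul_nonneg (hβ0 _) (hTpos _).le)
  refine ⟨fun x => (1 + β ‖x‖ * T ((r₁ / ‖x‖) • x))⁻¹, ?_, fun x => inv_pos.2 (hpos x), ?_, ?_⟩
  · exact (contDiff_const.add (contDiff_radial_cutoff_mul_homogeneous r₁ hβ hT hr₁
      fun r hr => hβ_eq r (.inl hr))).inv fun x => (hpos x).ne'
  · intro x hx
    simp [hβ_eq _ hx]
  · intro x hx
    have hcongr : Set.EqOn
        (fun r => 1 / (1 + β ‖(r / r₁) • x‖ * T ((r₁ / ‖(r / r₁) • x‖) • (r / r₁) • x))⁻¹)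
        (fun r => 1 + β r * T x) (Set.uIcc r₁ r₂) := by
      intro r hr
      rw [Set.uIcc_of_le hr₁₂.le] at hr
      have hr0 : 0 < r := hr₁.trans_le hr.1
      have hnorm : ‖(r / r₁) • x‖ = r := by
        rw [norm_smul, hx, Real.norm_of_nonneg (by positivity), div_mul_cancel₀ _ hr₁.ne']
      have hsmul : (r₁ / r) • (r / r₁) • x = x := by
        rw [smul_smul, div_mul_div_cancel₀ hr0.ne', div_self hr₁.ne', one_smul]
      simp only [hnorm, hsmul, one_div, inv_inv]
    rw [intervalIntegral.integral_congr hcongr, intervalIntegral.integral_add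
      intervalIntegrable_const ((hβ.continuous.intervalIntegrable _ _).mul_const _),
      intervalIntegral.integral_mul_const, hint]
    simp
end
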